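/- arXiv:2407.14471 — 12 statements merged into one kernel-verified Lean document; each statement's English description precedes it below -/
import Mathlib

section
/- Let Y be a linear subspace of a real Banach space X, let x ∈ X, y₀ ∈ Y and ε ∈ [0,1). Then the following are equivalent: (i) y₀ is an ε-best coapproximation to x out of Y; (ii) for every y ∈ Y, ‖x − y‖ ≥ ‖y₀ − y‖ − ε‖x − y₀‖; (iii) for every nonzero y ∈ Y there exists f ∈ J(y) such that |f(x − y₀)| ≤ ε‖x − y₀‖. -/
open Metric Set

variable {X : Type*} [NormedAddCommGroup X] [NormedSpace ℝ X]

/-- `J(x)`: the set of norm-one support functionals of `x`. -/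
def normingSet (x : X) : Set (X →L[ℝ] ℝ) := {f | ‖f‖ = 1 ∧ f x = ‖x‖}

/-- `y₀` is a best coapproximation to `x` out of `Y`. -/
def IsBestCoapprox (Y : Submodule ℝ X) (x y₀ : X) : Prop :=
  ∀ y ∈ Y, ‖y₀ - y‖ ≤ ‖x - y‖

/-- `Y` is an anti-coproximinal subspace of `X`. -/
def AntiCoproximinal (Y : Submodule ℝ X) : Prop :=
  ∀ x ∉ Y, ¬ ∃ y₀ ∈ Y, IsBestCoapprox Y x y₀

/-- Approximate Birkhoff-James orthogonality: `u ⊥_B^ε v`. -/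
def ApproxBJOrth (ε : ℝ) (u v : X) : Prop :=
  ∀ t : ℝ, ‖u + t • v‖ ≥ ‖u‖ - ε * ‖t • v‖

/-- `y₀` is an `ε`-best coapproximation to `x` out of `Y`. -/
def IsEpsBestCoapprox (Y : Submodule ℝ X) (ε : ℝ) (x y₀ : X) : Prop :=
  ∀ y ∈ Y, ApproxBJOrth ε y (x - y₀)

/-- `Y` is a strongly anti-coproximinal subspace of `X`. -/
def StronglyAntiCoproximinal (Y : Submodule ℝ X) : Prop :=
  ∀ x ∉ Y, ∀ ε : ℝ, 0 ≤ ε → ε < 1 → ¬ ∃ y₀ ∈ Y, IsEpsBestCoapprox Y ε x y₀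

/-- `x` is a smooth point: nonzero and `J(x)` is a singleton. -/
def SmoothPt (x : X) : Prop := x ≠ 0 ∧ ∃ f, normingSet x = {f}

/-- A smooth Banach space: every nonzero point is a smooth point. -/
def SmoothSpace (X : Type*) [NormedAddCommGroup X] [NormedSpace ℝ X] : Prop :=
  ∀ x : X, x ≠ 0 → SmoothPt x

/-- `𝒥_Y`: norm-one functionals supporting some norm-one smooth point of `Y`. -/
def JsetY (Y : Submodule ℝ X) : Set (X →L[ℝ] ℝ) :=
  {f | ‖f‖ = 1 ∧ ∃ y ∈ Y, SmoothPt y ∧ ‖y‖ = 1 ∧ f y = 1}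

/-- The Kadets-Klee property. -/
def KadetsKlee (Z : Type*) [NormedAddCommGroup Z] [NormedSpace ℝ Z] : Prop :=
  ∀ (z : ℕ → Z) (z₀ : Z),
    (∀ f : Z →L[ℝ] ℝ, Filter.Tendsto (fun k => f (z k)) Filter.atTop (nhds (f z₀))) →
    Filter.Tendsto (fun k => ‖z k‖) Filter.atTop (nhds ‖z₀‖) →
    Filter.Tendsto z Filter.atTop (nhds z₀)

theorem aux_exists_functional (u v : X) (hu : u ≠ 0) (δ : ℝ) (hδ : 0 ≤ δ)
    (h : ∀ t : ℝ, ‖u‖ ≤ ‖u + t • v‖ + δ * |t|) :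
    ∃ f ∈ normingSet u, |f v| ≤ δ := by
  let N : X → ℝ := fun z => ⨅ t : ℝ, (‖z + t • v‖ + δ * |t|)
  have hbdd : ∀ z : X, BddBelow (Set.range fun t : ℝ => ‖z + t • v‖ + δ * |t|) := by
    intro z
    refine ⟨0, ?_⟩
    rintro _ ⟨t, rfl⟩
    positivity
  have hle : ∀ z (t : ℝ), N z ≤ ‖z + t • v‖ + δ * |t| := fun z t => ciInf_le (hbdd z) t
  have hN0 : ∀ z, 0 ≤ N z := fun z => le_ciInf fun t => by positivity
  have N_hom : ∀ c : ℝ, 0 < c → ∀ z, N (c • z) = c * N z := by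
    intro c hc z
    change _ = c * (⨅ t : ℝ, (‖z + t • v‖ + δ * |t|))
    rw [Real.mul_iInf_of_nonneg hc.le]
    refine (Equiv.iInf_congr (Equiv.mulLeft₀ c hc.ne') ?_).symm
    intro t
    change ‖c • z + (c * t) • v‖ + δ * |c * t| = _
    simp only [mul_smul, ← smul_add, norm_smul, abs_mul, Real.norm_eq_abs,
      abs_of_pos hc]
    ring
  have N_add : ∀ z w, N (z + w) ≤ N z + N w := by
    intro z w
    refine le_ciInf_add_ciInf fun s t => (hle (z + w) (s + t)).trans ?_
    have h1 : ‖z + w + (s + t) • v‖ ≤ ‖z + s • v‖ + ‖w + t • v‖ := by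
      have : z + w + (s + t) • v = (z + s • v) + (w + t • v) := by module
      rw [this]; exact norm_add_le _ _
    have h2 := mul_le_mul_of_nonneg_left (abs_add_le s t) hδ
    linarith
  have hNu : ‖u‖ ≤ N u := le_ciInf h
  obtain ⟨g, hg1, hg2⟩ := exists_extension_of_le_sublinear
    (LinearPMap.mkSpanSingleton u ‖u‖ hu) N N_hom N_add (by
      rintro ⟨z, hz⟩
      obtain ⟨c, rfl⟩ := Submodule.mem_span_singleton.1 hz
      have e : (LinearPMap.mkSpanSingleton u ‖u‖ hu) ⟨c • u, hz⟩ = c • ‖u‖ :=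
        LinearPMap.mkSpanSingleton'_apply _ _ _ _ _
      rw [e]
      rcases lt_or_ge 0 c with hc | hc
      · simp only [N_hom c hc, smul_eq_mul]
        exact mul_le_mul_of_nonneg_left hNu hc.le
      · refine le_trans ?_ (hN0 _)
        exact mul_nonpos_of_nonpos_of_nonneg hc (norm_nonneg _))
  have hgu : g u = ‖u‖ := by
    have h1 := hg1 ⟨u, Submodule.mem_span_singleton_self u⟩
    have h2 := LinearPMap.mkSpanSingleton_apply ℝ ℝ (σ := RingHom.id ℝ) hu ‖u‖
    simpa using h1.trans h2
  have hgn : ∀ z, g z ≤ ‖z‖ := fun z => (hg2 z).trans (by simpa using hle z 0)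
  have hgb : ∀ z, ‖g z‖ ≤ 1 * ‖z‖ := by
    intro z
    rw [Real.norm_eq_abs, one_mul, abs_le]
    have := hgn (-z)
    rw [map_neg, norm_neg] at this
    exact ⟨by linarith, hgn z⟩
  refine ⟨g.mkContinuous 1 hgb, ⟨le_antisymm (LinearMap.mkContinuous_norm_le _ zero_le_one _) ?_,
    hgu⟩, ?_⟩
  · have h1 := (g.mkContinuous 1 hgb).le_opNorm u
    rw [LinearMap.mkContinuous_apply, hgu, norm_norm] at h1
    have : 0 < ‖u‖ := norm_pos_iff.2 hu
    nlinarith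
  · rw [LinearMap.mkContinuous_apply, abs_le]
    have h1 := (hg2 v).trans (hle v (-1))
    have h2 := (hg2 (-v)).trans (hle (-v) 1)
    rw [map_neg] at h2
    simp at h1 h2
    exact ⟨by linarith, h1⟩

theorem epsBestCoapprox_tfae [CompleteSpace X] (Y : Submodule ℝ X) (x y₀ : X)
    (hy₀ : y₀ ∈ Y) (ε : ℝ) (hε0 : 0 ≤ ε) (hε1 : ε < 1) :
    (IsEpsBestCoapprox Y ε x y₀ ↔
      ∀ y ∈ Y, ‖x - y‖ ≥ ‖y₀ - y‖ - ε * ‖x - y₀‖) ∧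
    ((∀ y ∈ Y, ‖x - y‖ ≥ ‖y₀ - y‖ - ε * ‖x - y₀‖) ↔
      ∀ y ∈ Y, y ≠ 0 → ∃ f ∈ normingSet y, |f (x - y₀)| ≤ ε * ‖x - y₀‖) := by
  have h12 : IsEpsBestCoapprox Y ε x y₀ →
      ∀ y ∈ Y, ‖x - y‖ ≥ ‖y₀ - y‖ - ε * ‖x - y₀‖ := by
    intro h y hy
    have := h (y₀ - y) (Y.sub_mem hy₀ hy) 1
    rw [one_smul] at this
    have e : y₀ - y + (x - y₀) = x - y := by abel
    rwa [e] at this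
  have h21 : (∀ y ∈ Y, ‖x - y‖ ≥ ‖y₀ - y‖ - ε * ‖x - y₀‖) → IsEpsBestCoapprox Y ε x y₀ := by
    intro h y hy t
    by_cases ht : t = 0
    · simp [ht]
    have h1 := h (y₀ - t⁻¹ • y) (Y.sub_mem hy₀ (Y.smul_mem _ hy))
    have e1 : y + t • (x - y₀) = t • (x - (y₀ - t⁻¹ • y)) := by
      have : t • (x - (y₀ - t⁻¹ • y)) = t • (x - y₀) + (t * t⁻¹) • y := by module
      rw [this, mul_inv_cancel₀ ht, one_smul, add_comm]
    have e2 : ‖y‖ = |t| * ‖y₀ - (y₀ - t⁻¹ • y)‖ := by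
      rw [sub_sub_cancel, ← Real.norm_eq_abs, ← norm_smul, smul_inv_smul₀ ht]
    rw [e1, e2, norm_smul, norm_smul, Real.norm_eq_abs]
    have := mul_le_mul_of_nonneg_left h1 (abs_nonneg t)
    linarith
  refine ⟨⟨h12, h21⟩, fun h y hy hy0 => ?_, fun h => h12 fun y hy t => ?_⟩
  · refine aux_exists_functional y (x - y₀) hy0 _ (by positivity) fun t => ?_
    have := h21 h y hy t
    rw [norm_smul, Real.norm_eq_abs] at this
    linarith
  · by_cases hy0 : y = 0
    · subst hy0
      rw [norm_zero]
      have : 0 ≤ ε * ‖t • (x - y₀)‖ := by positivity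
      have := norm_nonneg (0 + t • (x - y₀))
      linarith
    · obtain ⟨f, ⟨hf1, hf2⟩, hf3⟩ := h y hy hy0
      have h1 := f.le_opNorm (y + t • (x - y₀))
      rw [hf1, one_mul] at h1
      have h2 := (le_abs_self _).trans h1
      rw [map_add, map_smul, hf2, smul_eq_mul] at h2
      have h3 := neg_abs_le (t * f (x - y₀))
      rw [abs_mul] at h3
      have h4 := mul_le_mul_of_nonneg_left hf3 (abs_nonneg t)
      rw [norm_smul, Real.norm_eq_abs]
      linarith
end

section
/- Let Y be a dense linear subspace of a real Banach space X. Then Y is a strongly anti-coproximinal subspace of X. -/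
open Metric Set

variable {X : Type*} [NormedAddCommGroup X] [NormedSpace ℝ X]

theorem dense_subspace_stronglyAntiCoproximinal [CompleteSpace X]
    (Y : Submodule ℝ X) (hY : Dense (Y : Set X)) :
    StronglyAntiCoproximinal Y := by
  rintro x hx ε h0 h1 ⟨y₀, hy₀, h⟩
  have hv : 0 < ‖x - y₀‖ := by
    rw [norm_pos_iff, sub_ne_zero]
    rintro rfl
    exact hx hy₀
  have hδ : 0 < (1 - ε) * ‖x - y₀‖ / 2 := by
    have : 0 < 1 - ε := by linarith
    positivity
  obtain ⟨y, hy, hd⟩ := hY.exists_dist_lt (x - y₀) hδ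
  have h2 := h y hy (-1)
  rw [neg_one_smul, norm_neg, ← sub_eq_add_neg] at h2
  rw [dist_eq_norm, norm_sub_rev] at hd
  have h3 := norm_sub_norm_le (x - y₀) y
  rw [norm_sub_rev (x - y₀) y] at h3
  linarith
end

section
/- Let Y be a linear subspace of an n-dimensional smooth real Banach space X. Then Y is an anti-coproximinal subspace of X if and only if the linear span of 𝒥_Y (inside X*) has dimension n. -/
open Metric Set

variable {X : Type*} [NormedAddCommGroup X] [NormedSpace ℝ X]

theorem aux_sep [FiniteDimensional ℝ X] (S : Set (X →L[ℝ] ℝ)) :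
    Module.finrank ℝ (Submodule.span ℝ S) = Module.finrank ℝ X ↔
      ∀ z : X, (∀ f ∈ S, f z = 0) → z = 0 := by
  have e : (X →ₗ[ℝ] ℝ) ≃ₗ[ℝ] (X →L[ℝ] ℝ) := LinearMap.toContinuousLinearMap
  have hd : Module.finrank ℝ (X →L[ℝ] ℝ) = Module.finrank ℝ X := by
    rw [← e.finrank_eq]
    exact Subspace.dual_finrank_eq
  have : FiniteDimensional ℝ (X →L[ℝ] ℝ) := e.finiteDimensional
  constructor
  · intro h z hz
    have htop : Submodule.span ℝ S = ⊤ :=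
      Submodule.eq_top_of_finrank_eq (h.trans hd.symm)
    by_contra hne
    obtain ⟨g, -, hg⟩ := exists_dual_vector ℝ z (norm_ne_zero_iff.2 hne)
    have hall : ∀ f ∈ Submodule.span ℝ S, f z = 0 := by
      intro f hf
      induction hf using Submodule.span_induction with
      | mem f hf => exact hz f hf
      | zero => simp
      | add f g _ _ h1 h2 => simp [h1, h2]
      | smul a f _ h1 => simp [h1]
    have h0 : g z = 0 := hall g (htop ▸ Submodule.mem_top)
    rw [h0] at hg
    exact hne (norm_eq_zero.1 (by simpa using hg.symm))
  · intro h
    rw [← hd]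
    suffices htop : Submodule.span ℝ S = ⊤ by rw [htop, finrank_top]
    by_contra hne
    obtain ⟨φ, hφ0, hφ⟩ := Submodule.exists_le_ker_of_lt_top _ (lt_top_iff_ne_top.2 hne)
    let L : (X →ₗ[ℝ] ℝ) ≃ₗ[ℝ] (X →L[ℝ] ℝ) := LinearMap.toContinuousLinearMap
    let z : X := (Module.evalEquiv ℝ X).symm (φ ∘ₗ L.toLinearMap)
    have hz : ∀ f : X →L[ℝ] ℝ, f z = φ f := by
      intro f
      have := Module.apply_evalEquiv_symm_apply ℝ X (f : X →ₗ[ℝ] ℝ) (φ ∘ₗ L.toLinearMap)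
      refine (show f z = _ from this).trans ?_
      rfl
    have hz0 : z = 0 := h z fun f hf => by
      rw [hz]
      exact hφ (Submodule.subset_span hf)
    apply hφ0
    ext f
    rw [← hz f, hz0]
    simp

theorem aux_james (y z : X) (hy : y ≠ 0) (h : ∀ t : ℝ, ‖y‖ ≤ ‖y + t • z‖) :
    ∃ f ∈ normingSet y, f z = 0 := by
  let S : Submodule ℝ X := Submodule.span ℝ {z}
  have hle : ‖y‖ ≤ ‖(Submodule.Quotient.mk y : X ⧸ S)‖ := by
    refine QuotientAddGroup.le_norm_iff.2 fun m hm => ?_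
    have hm' : m - y ∈ S := (Submodule.Quotient.eq S).1 hm
    obtain ⟨t, ht⟩ := Submodule.mem_span_singleton.1 hm'
    have := h t
    rwa [ht, add_sub_cancel] at this
  have heq : ‖(Submodule.Quotient.mk y : X ⧸ S)‖ = ‖y‖ :=
    le_antisymm (Submodule.Quotient.norm_mk_le S y) hle
  have hpos : 0 < ‖y‖ := norm_pos_iff.2 hy
  obtain ⟨g, hg1, hg⟩ := exists_dual_vector ℝ (Submodule.Quotient.mk y : X ⧸ S)
    (by rw [heq]; exact hpos.ne')
  have hfy : (g.comp S.mkQL) y = ‖y‖ := by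
    rw [← heq]; exact hg
  refine ⟨g.comp S.mkQL, ⟨le_antisymm ?_ ?_, hfy⟩, ?_⟩
  · refine ContinuousLinearMap.opNorm_le_bound _ zero_le_one fun x => ?_
    calc ‖g (Submodule.Quotient.mk x)‖ ≤ ‖g‖ * ‖(Submodule.Quotient.mk x : X ⧸ S)‖ := g.le_opNorm _
      _ ≤ 1 * ‖x‖ := by
        rw [hg1]
        exact mul_le_mul_of_nonneg_left (Submodule.Quotient.norm_mk_le S x) zero_le_one
  · have := (g.comp S.mkQL).le_opNorm y
    rw [hfy, Real.norm_of_nonneg hpos.le] at this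
    nlinarith
  · have : (Submodule.Quotient.mk z : X ⧸ S) = 0 :=
      (Submodule.Quotient.mk_eq_zero S).2 (Submodule.mem_span_singleton_self z)
    change g (Submodule.Quotient.mk z) = 0
    rw [this, map_zero]

/-- Scaling: a vector which is a norm-one multiple is supported by some functional. -/
theorem aux_unit (hsm : SmoothSpace X) (Y : Submodule ℝ X) (y : X) (hyY : y ∈ Y) (hy : y ≠ 0) :
    ∃ f ∈ JsetY Y, f y = ‖y‖ := by
  have hn : ‖y‖ ≠ 0 := norm_ne_zero_iff.2 hy
  obtain ⟨f, hf1, hf⟩ := exists_dual_vector ℝ y hn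
  have hf' : f y = ‖y‖ := by simpa using hf
  refine ⟨f, ⟨hf1, ‖y‖⁻¹ • y, Y.smul_mem _ hyY, hsm _ ?_, ?_, ?_⟩, hf'⟩
  · exact smul_ne_zero (inv_ne_zero hn) hy
  · rw [norm_smul, norm_inv, norm_norm, inv_mul_cancel₀ hn]
  · rw [map_smul, hf', smul_eq_mul, inv_mul_cancel₀ hn]

theorem antiCoproximinal_iff_finrank_span_eq [FiniteDimensional ℝ X] (n : ℕ)
    (hn : Module.finrank ℝ X = n) (hsm : SmoothSpace X) (Y : Submodule ℝ X) :
    AntiCoproximinal Y ↔ Module.finrank ℝ (Submodule.span ℝ (JsetY Y)) = n := by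
  subst hn
  rw [aux_sep]
  constructor
  · intro hA z hz
    by_contra hne
    have hzY : z ∉ Y := by
      intro hzY
      obtain ⟨f, hf, hfz⟩ := aux_unit hsm Y z hzY hne
      rw [hz f hf] at hfz
      exact hne (norm_eq_zero.1 hfz.symm)
    refine hA z hzY ⟨0, Y.zero_mem, fun y hy => ?_⟩
    rw [zero_sub, norm_neg]
    by_cases hy0 : y = 0
    · simp [hy0]
    obtain ⟨f, hf, hfy⟩ := aux_unit hsm Y y hy hy0
    have h1 := f.le_opNorm (z - y)
    rw [map_sub, hz f hf, hfy, hf.1, zero_sub, norm_neg, norm_norm, one_mul] at h1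
    exact h1
  · rintro hsep x hx ⟨y₀, hy₀, hb⟩
    have hz : x - y₀ = 0 := by
      apply hsep
      rintro f ⟨hf1, y, hyY, ⟨hy0, g, hg⟩, hyn, hfy⟩
      obtain ⟨f', hf', hf'z⟩ := aux_james y (x - y₀) hy0 (by
        intro t
        by_cases ht : t = 0
        · simp [ht]
        have h1 := hb (y₀ - t⁻¹ • y) (Y.sub_mem hy₀ (Y.smul_mem _ hyY))
        have h2 := mul_le_mul_of_nonneg_left h1 (norm_nonneg t)
        rw [← norm_smul, ← norm_smul] at h2
        have e1 : t • (y₀ - (y₀ - t⁻¹ • y)) = y := by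
          rw [sub_sub_cancel, smul_inv_smul₀ ht]
        have e2 : t • (x - (y₀ - t⁻¹ • y)) = y + t • (x - y₀) := by
          rw [← sub_add, smul_add, smul_inv_smul₀ ht, add_comm]
        rwa [e1, e2] at h2)
      have hfm : f ∈ normingSet y := ⟨hf1, by rw [hfy, hyn]⟩
      rw [hg, Set.mem_singleton_iff] at hfm hf'
      rw [hfm, ← hf', hf'z]
    exact hx (by rw [sub_eq_zero.1 hz]; exact hy₀)
end

section
/- Let X = ℓ_p^n with 1 < p < ∞ and n ≥ 3. Then p = 2 if and only if no linear subspace Y of X with 1 < dim Y < n is an anti-coproximinal subspace of X. -/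
open Metric Set

variable {X : Type*} [NormedAddCommGroup X] [NormedSpace ℝ X]

open scoped ENNReal in
lemma aux_deriv {n : ℕ} (p : ℝ≥0∞) [Fact (1 ≤ p)] (hp1 : 1 < p) (hptop : p ≠ ⊤)
    (u z : PiLp p fun _ : Fin n => ℝ) (h : ∀ t : ℝ, ‖u‖ ≤ ‖u + t • z‖) :
    ∑ i, |u i| ^ (p.toReal - 2) * u i * z i = 0 := by
  have hp : 1 < p.toReal := by
    have := (ENNReal.toReal_lt_toReal (by simp) hptop).2 hp1
    simpa using this
  have hp0 : 0 < p.toReal := by linarith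
  have hn : ∀ v : PiLp p fun _ : Fin n => ℝ, ‖v‖ ^ p.toReal = ∑ i, |v i| ^ p.toReal := by
    intro v
    rw [PiLp.norm_eq_sum hp0, ← Real.rpow_mul (Finset.sum_nonneg fun i _ => by positivity)]
    rw [one_div, inv_mul_cancel₀ hp0.ne', Real.rpow_one]
    simp [Real.norm_eq_abs]
  have hd : HasDerivAt (fun t : ℝ => ∑ i, |u i + t * z i| ^ p.toReal)
      (∑ i, p.toReal * |u i + 0 * z i| ^ (p.toReal - 2) * (u i + 0 * z i) * z i) 0 := by
    apply HasDerivAt.fun_sum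
    intro i _
    have h1 : HasDerivAt (fun t : ℝ => u i + t * z i) (z i) 0 := by
      simpa using ((hasDerivAt_id (0:ℝ)).mul_const (z i)).const_add (u i)
    exact (hasDerivAt_abs_rpow (u i + 0 * z i) hp).comp (0:ℝ) h1
  have hm : IsLocalMin (fun t : ℝ => ∑ i, |u i + t * z i| ^ p.toReal) 0 := by
    refine Filter.Eventually.of_forall fun t => ?_
    have h2 := Real.rpow_le_rpow (norm_nonneg _) (h t) hp0.le
    rw [hn, hn] at h2
    simpa using h2
  have h3 := hm.hasDerivAt_eq_zero hd
  simp only [zero_mul, add_zero, mul_assoc] at h3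
  rw [← Finset.mul_sum] at h3
  simpa [mul_assoc] using (mul_eq_zero.1 h3).resolve_left hp0.ne'

open scoped ENNReal in
theorem lp_eq_two_iff_no_antiCoproximinal (n : ℕ) (hn : 3 ≤ n)
    (p : ℝ≥0∞) [Fact (1 ≤ p)] (hp1 : 1 < p) (hptop : p ≠ ⊤) :
    p = 2 ↔ ¬ ∃ Y : Submodule ℝ (PiLp p fun _ : Fin n => ℝ),
      1 < Module.finrank ℝ Y ∧ Module.finrank ℝ Y < n ∧ AntiCoproximinal Y := by
  constructor
  · rintro hp
    subst hp
    rintro ⟨Y, -, h2, h3⟩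
    have hY : ∃ x, x ∉ Y := by
      by_contra! hc
      have : Y = ⊤ := by ext x; simp [hc x]
      rw [this, finrank_top] at h2
      have h4 : Module.finrank ℝ (EuclideanSpace ℝ (Fin n)) = n := finrank_euclideanSpace_fin
      exact absurd h4 h2.ne
    obtain ⟨x, hx⟩ := hY
    let Y' : Submodule ℝ (EuclideanSpace ℝ (Fin n)) := Y
    let x' : EuclideanSpace ℝ (Fin n) := x
    refine h3 x hx ⟨Y'.starProjection x', Y'.starProjection_apply_mem x', fun y hy => ?_⟩
    have h5 : Y'.starProjection y = y := Submodule.starProjection_eq_self_iff.2 hy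
    have h6 := Y'.norm_starProjection_apply_le (x' - y)
    rw [map_sub, h5] at h6
    exact h6
  · intro h
    by_contra hp2
    apply h
    have hq : p.toReal ≠ 2 := by
      intro h; apply hp2
      rw [← ENNReal.ofReal_toReal hptop, h]; simp
    obtain ⟨a, b, c, hab, hac, hbc⟩ : ∃ a b c : Fin n, a ≠ b ∧ a ≠ c ∧ b ≠ c :=
      ⟨⟨0, by omega⟩, ⟨1, by omega⟩, ⟨2, by omega⟩, by simp, by simp, by simp⟩
    let f : Module.Dual ℝ (PiLp p fun _ : Fin n => ℝ) :=
      { toFun := fun v => v a + v b + v c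
        map_add' := by intro v w; simp; ring
        map_smul' := by intro v w; simp; ring }
    have hfv : ∀ v, f v = v a + v b + v c := fun v => rfl
    have hf : f ≠ 0 := by
      intro h0
      have := hfv (WithLp.toLp p (Pi.single a 1))
      rw [h0] at this
      simp [Pi.single_apply, hab.symm, hac.symm] at this
    have hr := Module.Dual.finrank_ker_add_one_of_ne_zero hf
    have hfr : Module.finrank ℝ (PiLp p fun _ : Fin n => ℝ) = n := by
      rw [(WithLp.linearEquiv p ℝ (Fin n → ℝ)).finrank_eq]; simp
    rw [hfr] at hr
    refine ⟨LinearMap.ker f, by omega, by omega, ?_⟩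
    rintro x hx ⟨y₀, hy₀, hbest⟩
    have key : ∀ u, f u = 0 → ∑ i, |u i| ^ (p.toReal - 2) * u i * (x - y₀) i = 0 := by
      intro u hu
      apply aux_deriv p hp1 hptop
      intro t
      by_cases ht : t = 0
      · simp [ht]
      have h1 := hbest (y₀ - t⁻¹ • u) (by
        rw [LinearMap.mem_ker] at *; rw [map_sub, map_smul, hu, hy₀]; simp)
      have e1 : u = t • (y₀ - (y₀ - t⁻¹ • u)) := by
        rw [sub_sub_cancel, smul_smul, mul_inv_cancel₀ ht, one_smul]
      have e2 : u + t • (x - y₀) = t • (x - (y₀ - t⁻¹ • u)) := by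
        rw [sub_sub_eq_add_sub, smul_sub, smul_sub, smul_add, smul_smul, mul_inv_cancel₀ ht, one_smul]
        abel
      rw [e2]
      conv_lhs => rw [e1]
      rw [norm_smul, norm_smul]
      exact mul_le_mul_of_nonneg_left h1 (norm_nonneg _)
    set z := x - y₀ with hz
    have key3 : ∀ α β γ : ℝ, α + β + γ = 0 →
        |α| ^ (p.toReal - 2) * α * z a + |β| ^ (p.toReal - 2) * β * z b
          + |γ| ^ (p.toReal - 2) * γ * z c = 0 := by
      intro α β γ h0
      have := key (WithLp.toLp p fun i => if i = a then α else if i = b then β else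
        if i = c then γ else 0) (by simp [hfv, hab.symm, hac.symm, hbc.symm, h0])
      rw [← this]
      have e : ∀ i, |(WithLp.toLp p fun i => if i = a then α else if i = b then β else
        if i = c then γ else 0 : PiLp p fun _ : Fin n => ℝ) i| ^ (p.toReal - 2) * (WithLp.toLp p fun i => if i = a then α else if i = b then β else
        if i = c then γ else 0 : PiLp p fun _ : Fin n => ℝ) i * z i = 
        (if i = a then |α| ^ (p.toReal - 2) * α * z i else 0) + 
        (if i = b then |β| ^ (p.toReal - 2) * β * z i else 0) + 
        (if i = c then |γ| ^ (p.toReal - 2) * γ * z i else 0) := by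
        intro i
        by_cases h1 : i = a
        · subst h1; simp [hab, hac]
        by_cases h2 : i = b
        · subst h2; simp [h1, hbc]
        by_cases h3 : i = c
        · subst h3; simp [h1, h2]
        simp [h1, h2, h3]
      rw [Finset.sum_congr rfl fun i _ => e i]
      simp [Finset.sum_add_distrib]
    have k1 := key3 1 (-1) 0 (by norm_num)
    have k2 := key3 1 0 (-1) (by norm_num)
    have k3 := key3 2 (-1) (-1) (by norm_num)
    simp at k1 k2 k3
    have hb : z b = z a := by linarith
    have hc : z c = z a := by linarith
    rw [hb, hc] at k3
    have ha : z a = 0 := by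
      have h4 : ((2:ℝ) ^ (p.toReal - 2) - 1) * (2 * z a) = 0 := by linarith
      rcases mul_eq_zero.1 h4 with h5 | h5
      · exfalso
        have h6 : (2:ℝ) ^ (p.toReal - 2) = 2 ^ (0:ℝ) := by rw [Real.rpow_zero]; linarith
        have := (Real.strictMono_rpow_of_base_gt_one (by norm_num : (1:ℝ) < 2)).injective h6
        exact hq (by linarith)
      · linarith
    apply hx
    have : f z = 0 := by rw [hfv, hb, hc, ha]; simp
    rw [hz, map_sub, LinearMap.mem_ker.1 hy₀, sub_zero] at this
    exact this
end

section
/- Let X be a smooth real Banach space with dim X ≥ 3. Then the norm of X is induced by an inner product (i.e., X is a Hilbert space) if and only if there does not exist a closed hyperspace of X (a closed linear subspace of codimension one) that is an anti-coproximinal subspace of X. -/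
open Metric Set

variable {X : Type*} [NormedAddCommGroup X] [NormedSpace ℝ X]

structure SuppSys (f : X → X →L[ℝ] ℝ) : Prop where
  le : ∀ x, x ≠ 0 → ∀ y, f x y ≤ ‖y‖
  self : ∀ x, x ≠ 0 → f x x = ‖x‖
  uniq : ∀ x, x ≠ 0 → ∀ g : X →L[ℝ] ℝ, (∀ y, g y ≤ ‖y‖) → g x = ‖x‖ → g = f x
  hyp : ∀ φ : X →L[ℝ] ℝ, φ ≠ 0 → ∃ z, φ z ≠ 0 ∧ ∀ h, h ≠ 0 → φ h = 0 → f h z = 0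

namespace SuppSys
variable {f : X → X →L[ℝ] ℝ}

lemma smul (S : SuppSys f) {x : X} (hx : x ≠ 0) {c : ℝ} (hc : 0 < c) : f (c • x) = f x := by
  symm
  apply S.uniq _ (smul_ne_zero hc.ne' hx) _ (S.le x hx)
  rw [map_smul, S.self x hx, norm_smul, Real.norm_eq_abs, abs_of_pos hc, smul_eq_mul]

lemma span2 (S : SuppSys f) {x v p z : X} (hx : x ≠ 0) (hv : v ≠ 0) (hp : p ≠ 0)
    (hxv : f x v = 0) (s t : ℝ) (hpe : p = s • x + t • v) (h1 : f x z = 0) (h2 : f v z = 0) :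
    f p z = 0 := by
  have nx : ‖x‖ ≠ 0 := norm_ne_zero_iff.2 hx
  have nv : ‖v‖ ≠ 0 := norm_ne_zero_iff.2 hv
  set b := f p v / ‖v‖ with hb
  set a := (f p x - b * f v x) / ‖x‖ with ha
  set φ : X →L[ℝ] ℝ := f p - a • f x - b • f v with hφ
  have e1 : φ v = 0 := by
    simp [hφ, hxv, S.self v hv, hb, nv]
  have e2 : φ x = 0 := by
    simp only [hφ, ContinuousLinearMap.sub_apply, ContinuousLinearMap.smul_apply, S.self x hx,
      smul_eq_mul, ha]
    field_simp
    ring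
  have e3 : φ p = 0 := by
    conv_lhs => rw [hpe]
    simp only [map_add, map_smul, e1, e2]
    simp
  by_cases h0 : φ = 0
  · have : φ z = 0 := by rw [h0]; rfl
    simpa [hφ, h1, h2] using this
  · exfalso
    obtain ⟨w, hw, hw2⟩ := S.hyp φ h0
    apply hw
    simp [hφ, hw2 x hx e2, hw2 v hv e1, hw2 p hp e3]

lemma lemA (S : SuppSys f) {x v v' : X} (hx : x ≠ 0) (hv' : v' ≠ 0)
    (h1 : f x v = 0) (h2 : f x v' = 0) (s : ℝ) :
    ‖s • x + (f v' v / ‖v'‖) • v'‖ ≤ ‖s • x + v‖ := by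
  have nv : ‖v'‖ ≠ 0 := norm_ne_zero_iff.2 hv'
  set p := s • x + (f v' v / ‖v'‖) • v' with hp
  by_cases p0 : p = 0
  · rw [p0, norm_zero]; exact norm_nonneg _
  have hz : f p (v - (f v' v / ‖v'‖) • v') = 0 := by
    apply S.span2 hx hv' p0 h2 s _ hp
    · simp [h1, h2]
    · simp [S.self v' hv', nv]
  have e : s • x + v = p + (v - (f v' v / ‖v'‖) • v') := by rw [hp]; abel
  calc ‖p‖ = f p (s • x + v) := by rw [e, map_add, hz, S.self p p0, add_zero]
    _ ≤ _ := S.le p p0 _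

lemma abs_le (S : SuppSys f) {x : X} (hx : x ≠ 0) (y : X) : |f x y| ≤ ‖y‖ := by
  rw [abs_le']
  refine ⟨S.le x hx y, ?_⟩
  have := S.le x hx (-y)
  simpa using this

lemma lemB (S : SuppSys f) {x v d : X} (hx : x ≠ 0)
    (h1 : f x v = 0) (h2 : f x d = 0) (h0 : ∀ t : ℝ, v + t • d ≠ 0) (s : ℝ) :
    ‖s • x + ‖v + d‖⁻¹ • (v + d)‖ ≤ ‖s • x + ‖v‖⁻¹ • v‖ := by
  obtain ⟨t0, -, ht0⟩ := (isCompact_Icc (a := (0:ℝ)) (b := 1)).exists_isMinOn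
    (f := fun t : ℝ => ‖v + t • d‖) ⟨0, by simp⟩ (by fun_prop)
  set c := ‖v + t0 • d‖ with hc
  have cpos : 0 < c := norm_pos_iff.2 (h0 _)
  have hcle : ∀ t : ℝ, 0 ≤ t → t ≤ 1 → c ≤ ‖v + t • d‖ := fun t a b => ht0 ⟨a, b⟩
  set g : ℝ → X := fun t => v + t • d with hg
  have step : ∀ t δ : ℝ, 0 ≤ t → t ≤ 1 → 0 ≤ δ →
      ‖s • x + ‖g (t+δ)‖⁻¹ • g (t+δ)‖ ≤ ‖s • x + ‖g t‖⁻¹ • g t‖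
        + (δ / c) * (f (g (t+δ)) d - f (g t) d) := by
    intro t δ ht ht1 hδ
    set a := g t with ha
    set b := g (t+δ) with hb
    have a0 : a ≠ 0 := h0 _
    have b0 : b ≠ 0 := h0 _
    have na : 0 < ‖a‖ := norm_pos_iff.2 a0
    have nb : 0 < ‖b‖ := norm_pos_iff.2 b0
    have hba : b = a + δ • d := by simp [ha, hb, hg, add_smul, add_assoc]
    have fxa : f x a = 0 := by simp [ha, hg, h1, h2]
    have fxb : f x b = 0 := by simp [hb, hg, h1, h2]
    have A := S.lemA (v := ‖a‖⁻¹ • a) (v' := b) hx b0 (by simp [fxa]) fxb s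
    set μ := ‖a‖⁻¹ * f b a with hμ
    have e1 : (f b (‖a‖⁻¹ • a) / ‖b‖) • b = μ • (‖b‖⁻¹ • b) := by
      rw [map_smul, smul_eq_mul, smul_smul]; rfl
    rw [e1] at A
    have μ1 : μ ≤ 1 := by
      rw [hμ, inv_mul_le_iff₀ na, mul_one]; exact S.le b b0 a
    have e2 : s • x + ‖b‖⁻¹ • b = (s • x + μ • (‖b‖⁻¹ • b)) + (1 - μ) • (‖b‖⁻¹ • b) := by
      rw [sub_smul, one_smul]; abel
    have e3 : ‖(1 - μ) • (‖b‖⁻¹ • b)‖ = 1 - μ := by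
      rw [norm_smul, norm_smul, norm_inv, norm_norm, inv_mul_cancel₀ nb.ne', mul_one,
        Real.norm_eq_abs, abs_of_nonneg (by linarith)]
    have e4 : f b a = ‖b‖ - δ * f b d := by
      have : a = b - δ • d := by rw [hba]; abel
      conv_lhs => rw [this]
      rw [map_sub, S.self b b0, map_smul, smul_eq_mul]
    have e5 : ‖a‖ + δ * f a d ≤ ‖b‖ := by
      have := S.le a a0 b
      conv_lhs at this => rw [hba]
      rwa [map_add, S.self a a0, map_smul, smul_eq_mul] at this
    have e6 : (1 - μ) * ‖a‖ = ‖a‖ - f b a := by rw [hμ]; field_simp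
    have ca : c ≤ ‖a‖ := hcle t ht ht1
    have e7 : 1 - μ ≤ (δ / c) * (f b d - f a d) := by
      rw [div_mul_eq_mul_div, le_div_iff₀ cpos]
      nlinarith
    calc ‖s • x + ‖b‖⁻¹ • b‖ ≤ ‖s • x + μ • (‖b‖⁻¹ • b)‖ + ‖(1 - μ) • (‖b‖⁻¹ • b)‖ := by
          conv_lhs => rw [e2]
          exact norm_add_le _ _
      _ ≤ _ := by rw [e3]; linarith
  have main : ∀ m : ℕ, ‖s • x + ‖v + d‖⁻¹ • (v + d)‖ ≤ ‖s • x + ‖v‖⁻¹ • v‖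
      + (2 * ‖d‖ / c) * (1 / ((m:ℝ) + 1)) := by
    intro m
    set δ : ℝ := 1 / ((m:ℝ)+1) with hδ
    have mp : (0:ℝ) < (m:ℝ) + 1 := by positivity
    have δ0 : 0 ≤ δ := by positivity
    have ind : ∀ i : ℕ, i ≤ m + 1 → ‖s • x + ‖g (i * δ)‖⁻¹ • g (i * δ)‖ ≤ ‖s • x + ‖g 0‖⁻¹ • g 0‖
        + (δ / c) * (f (g (i * δ)) d - f (g 0) d) := by
      intro i
      induction i with
      | zero => intro _; simp
      | succ i ih =>
        intro hi
        have h := ih (by omega)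
        have hi' : (i:ℝ) ≤ m + 1 := by exact_mod_cast (by omega : i ≤ m + 1)
        have := step (i * δ) δ (by positivity) (by rw [hδ, mul_one_div, div_le_one mp]; exact hi') δ0
        have e : ((i+1 : ℕ) : ℝ) * δ = i * δ + δ := by push_cast; ring
        rw [e]
        linarith
    have := ind (m+1) le_rfl
    have e : ((m+1 : ℕ) : ℝ) * δ = 1 := by rw [hδ]; push_cast; field_simp
    rw [e] at this
    have g0 : g 0 = v := by simp [hg]
    have g1 : g 1 = v + d := by simp [hg]
    rw [← g1, ← g0]
    refine this.trans ?_
    have k1 := (_root_.abs_le.1 (S.abs_le (h0 1) d)).2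
    have k2 := (_root_.abs_le.1 (S.abs_le (h0 0) d)).1
    have : (δ / c) * (f (g 1) d - f (g 0) d) ≤ (δ / c) * (2 * ‖d‖) := by
      apply mul_le_mul_of_nonneg_left _ (by positivity)
      change f (v + (1:ℝ) • d) d - f (v + (0:ℝ) • d) d ≤ _
      linarith
    have e : (δ / c) * (2 * ‖d‖) = (2 * ‖d‖ / c) * δ := by ring
    linarith
  have lim : Filter.Tendsto (fun m : ℕ => ‖s • x + ‖v‖⁻¹ • v‖
      + (2 * ‖d‖ / c) * (1 / ((m:ℝ) + 1))) Filter.atTop (nhds (‖s • x + ‖v‖⁻¹ • v‖ + (2 * ‖d‖ / c) * 0)) :=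
    (tendsto_one_div_add_atTop_nhds_zero_nat.const_mul _).const_add _
  rw [mul_zero, add_zero] at lim
  exact ge_of_tendsto' lim main

lemma iso_le (S : SuppSys f) (hdim : 3 ≤ Module.rank ℝ X) {x v : X} (hx : x ≠ 0) (hv : v ≠ 0)
    (h : f x v = 0) (s : ℝ) : ‖s • x - ‖v‖⁻¹ • v‖ ≤ ‖s • x + ‖v‖⁻¹ • v‖ := by
  have nx : ‖x‖ ≠ 0 := norm_ne_zero_iff.2 hx
  obtain ⟨u, hu⟩ : ∃ u, u ∉ Submodule.span ℝ {x, v} := by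
    by_contra! hcon
    have : Submodule.span ℝ {x, v} = ⊤ := by
      ext y; simp [hcon y]
    have h2 : Module.rank ℝ X ≤ 2 := by
      rw [← rank_top, ← this]
      refine (rank_span_le _).trans ?_
      refine (Cardinal.mk_insert_le).trans ?_
      rw [Cardinal.mk_singleton]
      norm_num
    have := hdim.trans h2
    norm_cast at this
  set k := u - (f x u / ‖x‖) • x with hk
  have fk : f x k = 0 := by simp [hk, S.self x hx, nx]
  have hne : ∀ a b : ℝ, a • v + b • k = 0 → b = 0 := by
    intro a b hab
    by_contra hb
    apply hu
    rw [Submodule.mem_span_pair]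
    refine ⟨f x u / ‖x‖, - (a / b), ?_⟩
    have : k = -(a/b) • v := by
      have : b • k = -(a • v) := by rw [eq_neg_iff_add_eq_zero, add_comm]; exact hab
      calc k = b⁻¹ • (b • k) := by rw [smul_smul, inv_mul_cancel₀ hb, one_smul]
        _ = _ := by rw [this, smul_neg, smul_smul, neg_smul]; congr 2; ring
    rw [← this, hk]; abel
  have B1 := S.lemB (v := v) (d := k - v) hx h (by simp [fk, h]) (by
    intro t ht
    have e : (1 - t) • v + t • k = 0 := by rw [← ht]; clear_value k; module
    have := hne _ _ e
    rw [this] at ht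
    simp at ht
    exact hv ht) s
  have B2 := S.lemB (v := k) (d := - v - k) hx fk (by simp [fk, h]) (by
    intro t ht
    have e : (- t) • v + (1 - t) • k = 0 := by
      rw [← ht]; clear_value k; module
    have h1 := hne _ _ e
    have : t = 1 := by linarith
    rw [this] at ht
    simp at ht
    exact hv ht) s
  have e1 : v + (k - v) = k := by abel
  have e2 : k + (- v - k) = - v := by abel
  rw [e1] at B1
  rw [e2, norm_neg, smul_neg, ← sub_eq_add_neg] at B2
  exact B2.trans B1

lemma iso (S : SuppSys f) (hdim : 3 ≤ Module.rank ℝ X) {x v : X} (hx : x ≠ 0)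
    (h : f x v = 0) (s : ℝ) : ‖s • x - v‖ = ‖s • x + v‖ := by
  by_cases hv : v = 0
  · simp [hv]
  have nv : 0 < ‖v‖ := norm_pos_iff.2 hv
  have key : ∀ s : ℝ, ‖s • x - ‖v‖⁻¹ • v‖ = ‖s • x + ‖v‖⁻¹ • v‖ := by
    intro s
    apply le_antisymm (S.iso_le hdim hx hv h s)
    have := S.iso_le hdim hx (neg_ne_zero.2 hv) (by simp [h]) s
    simpa [sub_eq_add_neg] using this
  have k := key (‖v‖⁻¹ * s)
  rw [mul_smul, ← smul_sub, ← smul_add, norm_smul, norm_smul] at k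
  exact mul_left_cancel₀ (by simp [hv]) k

/-- reflection negating `x` and fixing the kernel of `f x`. -/
lemma refl (S : SuppSys f) (hdim : 3 ≤ Module.rank ℝ X) {x : X} (hx : x ≠ 0) :
    ∃ R : X →L[ℝ] X, R x = -x ∧ (∀ v, f x v = 0 → R v = v) ∧ ∀ y, ‖R y‖ = ‖y‖ := by
  have nx : ‖x‖ ≠ 0 := norm_ne_zero_iff.2 hx
  refine ⟨ContinuousLinearMap.id ℝ X - (2 / ‖x‖) • (f x).smulRight x, ?_, ?_, ?_⟩
  · simp [S.self x hx, smul_smul, nx, two_smul]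
  · intro v hv; simp [hv]
  · intro y
    set v := y - (f x y / ‖x‖) • x with hv
    have fv : f x v = 0 := by simp [hv, S.self x hx, nx]
    have := S.iso hdim hx fv (f x y / ‖x‖)
    have e1 : (f x y / ‖x‖) • x + v = y := by rw [hv]; abel
    rw [e1] at this
    rw [← this, ← norm_neg]
    congr 1
    simp only [ContinuousLinearMap.sub_apply, ContinuousLinearMap.smul_apply,
      ContinuousLinearMap.id_apply, ContinuousLinearMap.smulRight_apply, hv, smul_smul]
    module

lemma symm0 (S : SuppSys f) (hdim : 3 ≤ Module.rank ℝ X) {x v : X} (hx : x ≠ 0) (hv : v ≠ 0)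
    (h : f x v = 0) : f v x = 0 := by
  obtain ⟨R, h1, h2, h3⟩ := S.refl hdim hx
  have : (f v).comp R = f v := by
    apply S.uniq v hv
    · intro y; rw [← h3 y]; exact S.le v hv _
    · simp [h2 v h, S.self v hv]
  have e := congrArg (fun g : X →L[ℝ] ℝ => g x) this
  simp [h1] at e
  linarith

lemma strict (S : SuppSys f) (hdim : 3 ≤ Module.rank ℝ X) {w v : X} (hw : w ≠ 0) (hv : v ≠ 0)
    (h : f w v = 0) {a b : ℝ} (ha : 0 ≤ a) (hab : a < b) : ‖a • w + v‖ < ‖b • w + v‖ := by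
  have hvw := S.symm0 hdim hw hv h
  have nw : 0 < ‖w‖ := norm_pos_iff.2 hw
  have vle : ∀ s : ℝ, ‖v‖ ≤ ‖s • w + v‖ := by
    intro s
    have := S.le v hv (s • w + v)
    simpa [hvw, S.self v hv] using this
  have pos : ∀ a b : ℝ, 0 < a → a < b → ‖a • w + v‖ < ‖b • w + v‖ := by
    intro a b ha hab
    set p := a • w + v with hp
    have p0 : p ≠ 0 := by
      intro h0
      have := vle a
      rw [← hp, h0, norm_zero] at this
      exact hv (norm_le_zero_iff.1 this)
    have k1 : ‖b • w + v‖ ≥ ‖p‖ + (b - a) * f p w := by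
      have := S.le p p0 (b • w + v)
      have e : b • w + v = p + (b - a) • w := by rw [hp]; module
      conv_lhs at this => rw [e]
      rwa [map_add, S.self p p0, map_smul, smul_eq_mul] at this
    have k2 : ‖v‖ ≥ ‖p‖ - a * f p w := by
      have := S.le p p0 v
      have e : v = p - a • w := by rw [hp]; module
      conv_lhs at this => rw [e]
      rwa [map_sub, S.self p p0, map_smul, smul_eq_mul] at this
    have k3 := vle a
    rw [← hp] at k3
    have k4 : 0 ≤ f p w := by
      by_contra! hc
      nlinarith
    have k5 : f p w ≠ 0 := by
      intro h0
      have := S.symm0 hdim p0 hw h0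
      rw [hp, map_add, map_smul, S.self w hw, h, add_zero, smul_eq_mul] at this
      exact (mul_pos ha nw).ne' this
    have : 0 < f p w := lt_of_le_of_ne k4 k5.symm
    nlinarith
  rcases ha.eq_or_lt with h0 | h0
  · subst h0
    have := pos (b/2) b (by linarith) (by linarith)
    have h2 := vle (b/2)
    simpa using h2.trans_lt this
  · exact pos a b h0 hab

lemma strict_abs (S : SuppSys f) (hdim : 3 ≤ Module.rank ℝ X) {w v : X} (hw : w ≠ 0) (hv : v ≠ 0)
    (h : f w v = 0) {a b : ℝ} (hab : |a| < b) : ‖a • w + v‖ < ‖b • w + v‖ := by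
  have := S.strict hdim hw hv h (abs_nonneg a) hab
  rcases abs_choice a with e | e
  · rwa [e] at this
  · rw [e] at this
    have i := S.iso hdim hw h a
    have e2 : -a • w + v = -(a • w - v) := by module
    rw [e2, norm_neg, i] at this
    exact this

lemma diag (S : SuppSys f) (hdim : 3 ≤ Module.rank ℝ X) {x y : X} (hxy : ‖x‖ = ‖y‖)
    (hx : x ≠ 0) (hw : x + y ≠ 0) : f (x + y) (x - y) = 0 := by
  set w := x + y with hwe
  have nw : 0 < ‖w‖ := norm_pos_iff.2 hw
  set a := f w (x - y) / ‖w‖ with ha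
  set v := (x - y) - a • w with hv
  have fv : f w v = 0 := by simp [hv, S.self w hw, ha, nw.ne']
  have e1 : (1 + a) • w + v = (2:ℝ) • x := by rw [hv, hwe]; module
  have e2 : (1 - a) • w - v = (2:ℝ) • y := by rw [hv, hwe]; module
  have n1 : ‖(1 + a) • w + v‖ = ‖(1 - a) • w - v‖ := by rw [e1, e2, norm_smul, norm_smul, hxy]
  have a0 : a = 0 := by
    by_cases v0 : v = 0
    · rw [v0, add_zero, sub_zero, norm_smul, norm_smul] at n1
      have := mul_right_cancel₀ nw.ne' n1
      simp only [Real.norm_eq_abs] at this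
      rcases abs_eq_abs.1 this with h | h <;> linarith
    · rw [S.iso hdim hw fv] at n1
      rcases lt_trichotomy a 0 with h | h | h
      · have := S.strict_abs hdim hw v0 fv (a := 1 + a) (b := 1 - a)
          (abs_lt.2 ⟨by linarith, by linarith⟩)
        linarith
      · exact h
      · have := S.strict_abs hdim hw v0 fv (a := 1 - a) (b := 1 + a)
          (abs_lt.2 ⟨by linarith, by linarith⟩)
        linarith
  rw [ha, div_eq_zero_iff] at a0
  exact a0.resolve_right nw.ne'

lemma symm1 (S : SuppSys f) (hdim : 3 ≤ Module.rank ℝ X) {x y : X} (hxy : ‖x‖ = ‖y‖)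
    (hx : x ≠ 0) (hy : y ≠ 0) : f x y = f y x := by
  by_cases hw : x + y = 0
  · have e : y = -x := (neg_eq_of_add_eq_zero_right hw).symm
    have e' : x = -y := by rw [e, neg_neg]
    have k1 : f x y = -‖x‖ := by
      calc f x y = f x (-x) := by rw [← e]
        _ = _ := by rw [map_neg, S.self x hx]
    have k2 : f y x = -‖y‖ := by
      calc f y x = f y (-y) := by rw [← e']
        _ = _ := by rw [map_neg, S.self y hy]
    rw [k1, k2, hxy]
  · have hd := S.diag hdim hxy hx hw
    obtain ⟨R, h1, h2, h3⟩ := S.refl hdim hw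
    have k := h2 _ hd
    rw [map_add] at h1
    rw [map_sub] at k
    have Rx : R x = -y := by
      have : (2:ℝ) • R x = (2:ℝ) • (-y) := by
        calc (2:ℝ) • R x = (R x + R y) + (R x - R y) := by module
          _ = _ := by rw [h1, k]; module
      exact smul_right_injective X (two_ne_zero) this
    have Ry : R y = -x := by
      rw [Rx] at h1
      calc R y = (-y + R y) + y := by abel
        _ = _ := by rw [h1]; abel
    have : -((f x).comp R) = f y := by
      apply S.uniq y hy
      · intro z
        have := S.le x hx (-(R z))
        rw [norm_neg, h3] at this
        simpa using this
      · simp [Ry, S.self x hx, hxy]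
    rw [← this]
    simp [Rx]

lemma symm2 (S : SuppSys f) (hdim : 3 ≤ Module.rank ℝ X) (x y : X) :
    ‖x‖ * f x y = ‖y‖ * f y x := by
  by_cases hx : x = 0
  · simp [hx]
  by_cases hy : y = 0
  · simp [hy]
  have nx : 0 < ‖x‖ := norm_pos_iff.2 hx
  have ny : 0 < ‖y‖ := norm_pos_iff.2 hy
  have c : 0 < ‖x‖ / ‖y‖ := by positivity
  have := S.symm1 hdim (x := x) (y := (‖x‖ / ‖y‖) • y)
    (by rw [norm_smul, Real.norm_eq_abs, abs_of_pos c]; field_simp) hx (smul_ne_zero c.ne' hy)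
  rw [S.smul hy c, map_smul, smul_eq_mul] at this
  rw [← this]; field_simp

lemma ips (S : SuppSys f) (hdim : 3 ≤ Module.rank ℝ X) : InnerProductSpaceable X := by
  constructor
  intro x y
  have self : ∀ z : X, ‖z‖ * ‖z‖ = ‖z‖ * f z z := by
    intro z
    by_cases hz : z = 0
    · simp [hz]
    · rw [S.self z hz]
  rw [self (x+y), self (x-y), self x, self y]
  have a1 := S.symm2 hdim (x+y) x
  have a2 := S.symm2 hdim (x+y) y
  have a3 := S.symm2 hdim (x-y) x
  have a4 := S.symm2 hdim (x-y) y
  have a5 := S.symm2 hdim x y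
  have b1 : ‖x+y‖ * f (x+y) (x+y) = ‖x+y‖ * f (x+y) x + ‖x+y‖ * f (x+y) y := by
    rw [map_add, mul_add]
  have b2 : ‖x-y‖ * f (x-y) (x-y) = ‖x-y‖ * f (x-y) x - ‖x-y‖ * f (x-y) y := by
    rw [map_sub, mul_sub]
  rw [b1, b2, a1, a2, a3, a4]
  simp only [map_add, map_sub]
  linarith

end SuppSys

lemma exists_suppSys (hdim : 3 ≤ Module.rank ℝ X) (hsm : SmoothSpace X)
    (H : ¬ ∃ Y : Submodule ℝ X, IsClosed (Y : Set X) ∧ Module.rank ℝ (X ⧸ Y) = 1 ∧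
        AntiCoproximinal Y) : ∃ f : X → X →L[ℝ] ℝ, SuppSys f := by
  have h1 : ∀ x : X, ∃ g : X →L[ℝ] ℝ, x ≠ 0 → normingSet x = {g} := by
    intro x
    by_cases hx : x = 0
    · exact ⟨0, fun h => absurd hx h⟩
    · obtain ⟨-, g, hg⟩ := hsm x hx
      exact ⟨g, fun _ => hg⟩
  choose f hf using h1
  have mem : ∀ x, x ≠ 0 → ‖f x‖ = 1 ∧ f x x = ‖x‖ := by
    intro x hx
    have : f x ∈ normingSet x := by rw [hf x hx]; rfl
    exact this
  have hle : ∀ x, x ≠ 0 → ∀ y, f x y ≤ ‖y‖ := by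
    intro x hx y
    have := (f x).le_opNorm y
    rw [(mem x hx).1, one_mul] at this
    exact (le_abs_self _).trans this
  have huniq : ∀ x, x ≠ 0 → ∀ g : X →L[ℝ] ℝ, (∀ y, g y ≤ ‖y‖) → g x = ‖x‖ → g = f x := by
    intro x hx g hg hgx
    have nx : 0 < ‖x‖ := norm_pos_iff.2 hx
    have : g ∈ normingSet x := by
      refine ⟨le_antisymm ?_ ?_, hgx⟩
      · apply ContinuousLinearMap.opNorm_le_bound _ zero_le_one
        intro y
        rw [one_mul, Real.norm_eq_abs, abs_le']
        refine ⟨hg y, ?_⟩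
        have := hg (-y)
        simpa using this
      · have := g.le_opNorm x
        rw [hgx, norm_norm] at this
        exact le_of_mul_le_mul_right (by linarith) nx
    rw [hf x hx] at this
    exact this
  refine ⟨f, hle, fun x hx => (mem x hx).2, huniq, ?_⟩
  intro φ hφ
  have hA : ¬ AntiCoproximinal (LinearMap.ker (φ : X →ₗ[ℝ] ℝ)) := by
    intro hA
    apply H
    refine ⟨_, ?_, ?_, hA⟩
    · exact φ.isClosed_ker
    · have hs : Function.Surjective (φ : X →ₗ[ℝ] ℝ) := by
        apply LinearMap.surjective
        intro h
        apply hφ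
        ext y
        exact congrArg (fun g : X →ₗ[ℝ] ℝ => g y) h
      have := ((φ : X →ₗ[ℝ] ℝ).quotKerEquivOfSurjective hs).lift_rank_eq
      simpa using this
  unfold AntiCoproximinal at hA
  push Not at hA
  obtain ⟨x, hx, y₀, hy₀, hb⟩ := hA
  have hx : φ x ≠ 0 := hx
  have hy₀ : φ y₀ = 0 := hy₀
  set z := x - y₀ with hz
  have φz : φ z ≠ 0 := by simpa [hz, hy₀] using hx
  have b1 : ∀ w, φ w = 0 → ‖w‖ ≤ ‖w + z‖ := by
    intro w hw
    have := hb (y₀ - w) (show φ (y₀ - w) = 0 by simp [hy₀, hw])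
    have e1 : y₀ - (y₀ - w) = w := by abel
    have e2 : x - (y₀ - w) = w + z := by rw [hz]; abel
    rwa [e1, e2] at this
  have b2 : ∀ w, φ w = 0 → ∀ t : ℝ, ‖w‖ ≤ ‖w + t • z‖ := by
    intro w hw t
    by_cases ht : t = 0
    · simp [ht]
    have := b1 (t⁻¹ • w) (by simp [hw])
    have e : w + t • z = t • (t⁻¹ • w + z) := by rw [smul_add, smul_smul, mul_inv_cancel₀ ht, one_smul]
    have e' : w = t • (t⁻¹ • w) := by rw [smul_smul, mul_inv_cancel₀ ht, one_smul]
    rw [e, norm_smul]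
    conv_lhs => rw [e', norm_smul]
    gcongr
  refine ⟨z, φz, ?_⟩
  intro h hh hφh
  set P : X →L[ℝ] X := ContinuousLinearMap.id ℝ X - (φ z)⁻¹ • φ.smulRight z with hP
  have Pz : P z = 0 := by simp [hP, smul_smul, φz]
  have Ph : P h = h := by simp [hP, hφh]
  have PP : ∀ y, ‖P y‖ ≤ ‖y‖ := by
    intro y
    have := b2 (P y) (by simp [hP]; field_simp; ring) ((φ z)⁻¹ * φ y)
    have e : P y + ((φ z)⁻¹ * φ y) • z = y := by simp [hP, smul_smul]
    rwa [e] at this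
  have : (f h).comp P = f h := by
    apply huniq h hh
    · intro y; exact (hle h hh _).trans (PP y)
    · simp [Ph, (mem h hh).2]
  rw [← this]
  simp [Pz]

lemma ips_forward [CompleteSpace X] (h : InnerProductSpaceable X) :
      ¬ ∃ Y : Submodule ℝ X, IsClosed (Y : Set X) ∧ Module.rank ℝ (X ⧸ Y) = 1 ∧
        AntiCoproximinal Y := by
  rintro ⟨Y, hc, hr, hA⟩
  have : ∃ x, x ∉ Y := by
    by_contra! hcon
    have : Y = ⊤ := by ext y; simp [hcon y]
    subst this
    have := rank_subsingleton' ℝ (X ⧸ (⊤ : Submodule ℝ X))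
    rw [this] at hr
    exact zero_ne_one hr
  obtain ⟨x, hx⟩ := this
  apply hA x hx
  letI : InnerProductSpace ℝ X := InnerProductSpace.ofNorm ℝ h.parallelogram_identity
  obtain ⟨v, hv, hmin⟩ := Submodule.exists_norm_eq_iInf_of_complete_subspace Y hc.isComplete x
  have horth := (Submodule.norm_eq_iInf_iff_real_inner_eq_zero Y hv).1 hmin
  refine ⟨v, hv, ?_⟩
  intro y hy
  have h0 := horth (v - y) (Y.sub_mem hv hy)
  have e : x - y = (v - y) + (x - v) := by abel
  have := norm_add_sq_eq_norm_sq_add_norm_sq_of_inner_eq_zero (v - y) (x - v) (by rw [real_inner_comm]; exact h0)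
  rw [← e] at this
  nlinarith [norm_nonneg (x - y), norm_nonneg (v - y), norm_nonneg (x - v)]

theorem innerProductSpaceable_iff_no_antiCoproximinal_hyperspace [CompleteSpace X]
    (hdim : 3 ≤ Module.rank ℝ X) (hsm : SmoothSpace X) :
    InnerProductSpaceable X ↔
      ¬ ∃ Y : Submodule ℝ X, IsClosed (Y : Set X) ∧ Module.rank ℝ (X ⧸ Y) = 1 ∧
        AntiCoproximinal Y := by
  constructor
  · exact ips_forward
  · intro H
    obtain ⟨f, S⟩ := exists_suppSys hdim hsm H
    exact S.ips hdim
end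

section
/- Let Y be a linear subspace of a real Banach space X. If for each x ∈ X \ Y there exists a nonzero y ∈ Y such that J(y) ⊆ J(x) ∪ J(−x), then Y is a strongly anti-coproximinal subspace of X. -/
open Metric Set

variable {X : Type*} [NormedAddCommGroup X] [NormedSpace ℝ X]

lemma aux_support (ε : ℝ) (y z : X) (hyz : ApproxBJOrth ε y z) :
    ∃ f : X →L[ℝ] ℝ, ‖f‖ ≤ 1 ∧ f y = ‖y‖ ∧ f z ≤ ε * ‖z‖ := by
  have h1 : ∀ n : ℕ, ∃ f : X →L[ℝ] ℝ, ‖f‖ ≤ 1 ∧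
      f z ≤ ε * ‖z‖ ∧ ‖y‖ - (1 / ((n : ℝ) + 1)) * (2 * ‖z‖) ≤ f y := by
    intro n
    obtain ⟨t, ht⟩ : ∃ t : ℝ, t = 1 / ((n : ℝ) + 1) := ⟨_, rfl⟩
    have htp : 0 < t := by rw [ht]; positivity
    rw [← ht]
    obtain ⟨f, hf, hfx⟩ := exists_dual_vector'' ℝ (y + (-t) • z)
    have hle : ∀ w, |f w| ≤ ‖w‖ := fun w => by
      have := f.le_of_opNorm_le hf w
      simpa using this
    have e : f y - t * f z = ‖y + (-t) • z‖ := by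
      have : f (y + (-t) • z) = f y + (-t) * f z := by
        rw [map_add, map_smul, smul_eq_mul]
      have h2 : f (y + (-t) • z) = ‖y + (-t) • z‖ := by simpa using hfx
      linarith
    have h3 := hyz (-t)
    have h4 : ‖(-t) • z‖ = t * ‖z‖ := by
      rw [norm_smul, norm_neg, Real.norm_of_nonneg htp.le]
    have h5 := (abs_le.1 (hle y)).2
    have h6 := (abs_le.1 (hle z)).1
    have h7 : ‖y‖ ≤ ‖y + (-t) • z‖ + ‖(-t) • z‖ := by
      simpa using norm_sub_le (y + (-t) • z) ((-t) • z)
    rw [h4] at h3 h7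
    refine ⟨f, hf, ?_, ?_⟩
    · have : t * f z ≤ t * (ε * ‖z‖) := by nlinarith
      exact le_of_mul_le_mul_left this htp
    · nlinarith
  choose F hF hFz hFy using h1
  have hc := WeakDual.isCompact_closedBall (𝕜 := ℝ) (0 : StrongDual ℝ X) 1
  obtain ⟨g, hg, hlim⟩ := hc.ultrafilter_le_nhds'
    ((Filter.hyperfilter ℕ).map fun n => StrongDual.toWeakDual (F n))
    (Ultrafilter.mem_map.2 (Filter.Eventually.of_forall fun n => by
      simpa using hF n))
  have hlim' : Filter.Tendsto (fun n => StrongDual.toWeakDual (F n))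
    (Filter.hyperfilter ℕ : Filter ℕ) (nhds g) := hlim
  have hev : ∀ w : X, Filter.Tendsto (fun n => F n w)
      (Filter.hyperfilter ℕ : Filter ℕ) (nhds (g w)) := fun w =>
    ((WeakDual.eval_continuous w).tendsto g).comp hlim'
  have hg1 : ‖WeakDual.toStrongDual g‖ ≤ 1 := by simpa using hg
  refine ⟨WeakDual.toStrongDual g, hg1, le_antisymm ?_ ?_, ?_⟩
  · have := (WeakDual.toStrongDual g).le_of_opNorm_le hg1 y
    exact (le_abs_self _).trans (by simpa using this)
  · have h0 : Filter.Tendsto (fun n : ℕ => ‖y‖ - (1 / ((n : ℝ) + 1)) * (2 * ‖z‖))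
        (Filter.hyperfilter ℕ : Filter ℕ) (nhds ‖y‖) := by
      have := ((tendsto_one_div_add_atTop_nhds_zero_nat (𝕜 := ℝ)).mul_const (2 * ‖z‖)).const_sub ‖y‖
      rw [zero_mul, sub_zero] at this
      exact this.mono_left Nat.hyperfilter_le_atTop
    exact le_of_tendsto_of_tendsto' h0 (hev y) hFy
  · exact le_of_tendsto' (hev z) hFz

lemma aux_norming {y : X} (hy : y ≠ 0) {f : X →L[ℝ] ℝ} (hf : ‖f‖ ≤ 1) (hfy : f y = ‖y‖) :
    f ∈ normingSet y := by
  refine ⟨le_antisymm hf ?_, hfy⟩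
  have h1 := f.le_opNorm y
  rw [hfy, norm_norm] at h1
  have := norm_pos_iff.2 hy
  by_contra hlt
  nlinarith [not_le.1 hlt]

theorem stronglyAntiCoproximinal_of_support_subset [CompleteSpace X]
    (Y : Submodule ℝ X)
    (h : ∀ x : X, x ∉ Y →
      ∃ y ∈ Y, y ≠ 0 ∧ normingSet y ⊆ normingSet x ∪ normingSet (-x)) :
    StronglyAntiCoproximinal Y := by
  rintro x hx ε hε0 hε1 ⟨y₀, hy₀, hb⟩
  obtain ⟨z, hz⟩ : ∃ z, z = x - y₀ := ⟨_, rfl⟩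
  have hzY : z ∉ Y := fun hm => hx (by
    have := Y.add_mem hm hy₀
    simpa [hz] using this)
  have hzp : 0 < ‖z‖ := norm_pos_iff.2 fun h0 => hzY (h0 ▸ Y.zero_mem)
  obtain ⟨y, hyY, hy, hsub⟩ := h z hzY
  have ho : ApproxBJOrth ε y z := hz ▸ hb y hyY
  have ho' : ApproxBJOrth ε y (-z) := fun t => by
    have := ho (-t)
    simpa using this
  have key : ∀ f : X →L[ℝ] ℝ, ‖f‖ ≤ 1 → f y = ‖y‖ → f z = ‖z‖ ∨ f z = -‖z‖ := by
    intro f hf hfy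
    rcases hsub (aux_norming hy hf hfy) with h1 | h1
    · exact Or.inl h1.2
    · right
      have := h1.2
      rw [map_neg, norm_neg] at this
      linarith
  obtain ⟨f, hf, hfy, hfz⟩ := aux_support ε y z ho
  obtain ⟨g, hg, hgy, hgz⟩ := aux_support ε y (-z) ho'
  rw [map_neg, norm_neg] at hgz
  have hm := key ((1 / 2 : ℝ) • (f + g)) (by
    rw [norm_smul]
    have := norm_add_le f g
    norm_num
    linarith) (by
    simp [hfy, hgy]
    ring)
  have e : ((1 / 2 : ℝ) • (f + g)) z = (1 / 2) * (f z + g z) := by simp [mul_add]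
  rw [e] at hm
  rcases key f hf hfy with h1 | h1 <;> rcases key g hg hgy with h2 | h2 <;>
    rcases hm with h3 | h3 <;> nlinarith
end

section
/- Let X be a finite-dimensional real Banach space that is smooth or strictly convex. Then no proper linear subspace of X is a strongly anti-coproximinal subspace of X. -/
open Metric Set

variable {X : Type*} [NormedAddCommGroup X] [NormedSpace ℝ X]

lemma key_aux [FiniteDimensional ℝ X] (Y : Submodule ℝ X) (z : X) (hz : ‖z‖ = 1) (hzY : z ∉ Y)
    (H : ∀ y ∈ Y, ‖y‖ = 1 → ∀ f : X →L[ℝ] ℝ, ‖f‖ = 1 → f y = 1 → |f z| < 1) :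
    ¬ StronglyAntiCoproximinal Y := by
  intro hS
  have : ProperSpace X := FiniteDimensional.proper ℝ X
  have : ProperSpace (X →L[ℝ] ℝ) := FiniteDimensional.proper ℝ (X →L[ℝ] ℝ)
  let K : Set (X × (X →L[ℝ] ℝ)) :=
    (((Y : Set X) ∩ sphere 0 1) ×ˢ sphere 0 1) ∩ {p | p.2 p.1 = 1}
  have hK : IsCompact K := by
    apply IsCompact.inter_right
    · exact ((isCompact_sphere 0 1).inter_left Y.closed_of_finiteDimensional).prod
        (isCompact_sphere 0 1)
    · exact isClosed_eq (by fun_prop) continuous_const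
  obtain ⟨ε, h0, h1, hε⟩ : ∃ ε : ℝ, 0 ≤ ε ∧ ε < 1 ∧ ∀ p ∈ K, |p.2 z| ≤ ε := by
    rcases K.eq_empty_or_nonempty with he | hne
    · exact ⟨0, le_rfl, one_pos, by simp [he]⟩
    · obtain ⟨p, hp, hm⟩ := hK.exists_isMaxOn hne
        (f := fun p : X × (X →L[ℝ] ℝ) => |p.2 z|) (by fun_prop)
      refine ⟨|p.2 z|, abs_nonneg _, ?_, fun q hq => hm hq⟩
      obtain ⟨⟨⟨a, b⟩, c⟩, d⟩ := hp
      exact H p.1 a (by simpa using b) p.2 (by simpa using c) d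
  refine hS z hzY ε h0 h1 ⟨0, Y.zero_mem, ?_⟩
  intro y hy t
  rw [sub_zero, norm_smul, hz, mul_one, Real.norm_eq_abs]
  by_cases hy0 : y = 0
  · subst hy0
    have := norm_nonneg (0 + t • z)
    have := mul_nonneg h0 (abs_nonneg t)
    simp only [norm_zero]
    linarith
  · obtain ⟨f, hf, hfy⟩ := exists_dual_vector ℝ y (norm_ne_zero_iff.2 hy0)
    have hfy : f y = ‖y‖ := by simpa using hfy
    have hn : ‖y‖ ≠ 0 := norm_ne_zero_iff.2 hy0
    have hb := hε (‖y‖⁻¹ • y, f) ⟨⟨⟨Y.smul_mem _ hy, by simp [norm_smul, hn]⟩, by simpa using hf⟩,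
      by simp [hfy, hn]⟩
    have h2 := f.le_opNorm (y + t • z)
    rw [hf, one_mul, Real.norm_eq_abs] at h2
    have h3 := (abs_le.1 h2).2
    rw [map_add, map_smul, hfy, smul_eq_mul] at h3
    have h4 : |t * f z| ≤ ε * |t| := by
      rw [abs_mul, mul_comm]; exact mul_le_mul_of_nonneg_right hb (abs_nonneg t)
    have := (abs_le.1 h4).1
    linarith

lemma sc_aux [StrictConvexSpace ℝ X] (y z : X) (hy : ‖y‖ = 1) (hz : ‖z‖ = 1)
    (f : X →L[ℝ] ℝ) (hf : ‖f‖ = 1) (h1 : f y = 1) (h2 : f z = 1) : y = z := by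
  rw [← sameRay_iff_of_norm_eq (hy.trans hz.symm), sameRay_iff_norm_add]
  apply le_antisymm (norm_add_le _ _)
  have h := (le_abs_self _).trans (f.le_opNorm (y + z))
  rw [hf, map_add, h1, h2] at h
  linarith

lemma attain_aux [FiniteDimensional ℝ X] (Y : Submodule ℝ X) (hY : Y ≠ ⊤) :
    ∃ (g : X →L[ℝ] ℝ) (z : X), ‖g‖ = 1 ∧ ‖z‖ = 1 ∧ g z = 1 ∧ ∀ y ∈ Y, g y = 0 := by
  have : ProperSpace X := FiniteDimensional.proper ℝ X
  obtain ⟨g0, hg0, hk⟩ := Submodule.exists_le_ker_of_lt_top Y (lt_top_iff_ne_top.2 hY)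
  obtain ⟨w, hw⟩ : ∃ w, g0 w ≠ 0 := by
    by_contra! hc
    exact hg0 (LinearMap.ext hc)
  let G : X →L[ℝ] ℝ := LinearMap.toContinuousLinearMap g0
  have hG : ∀ x, G x = g0 x := fun x => rfl
  have hG0 : G ≠ 0 := fun hc => hw (by rw [← hG, hc]; rfl)
  have hGn : ‖G‖ ≠ 0 := norm_ne_zero_iff.2 hG0
  have hw0 : w ≠ 0 := by rintro rfl; simp at hw
  have hwn : ‖w‖ ≠ 0 := norm_ne_zero_iff.2 hw0
  obtain ⟨z, hz, hm⟩ := (isCompact_sphere (0 : X) 1).exists_isMaxOn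
    ⟨‖w‖⁻¹ • w, by simp [norm_smul, hwn]⟩ (f := fun x => |G x|) (by fun_prop)
  have hz1 : ‖z‖ = 1 := by simpa using hz
  have e : ‖G‖ = |G z| := by
    apply le_antisymm
    · apply G.opNorm_le_bound (abs_nonneg _)
      intro x
      by_cases hx : x = 0
      · simp [hx]
      have hxn : ‖x‖ ≠ 0 := norm_ne_zero_iff.2 hx
      have h := hm (show ‖x‖⁻¹ • x ∈ sphere (0 : X) 1 by simp [norm_smul, hxn])
      simp only [mem_ofPred_eq, map_smul, smul_eq_mul, abs_mul, abs_inv, abs_norm] at h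
      rw [inv_mul_le_iff₀ (by positivity)] at h
      rw [Real.norm_eq_abs]; linarith
    · simpa [hz1] using G.le_opNorm z
  have hGz : G z ≠ 0 := fun hc => hGn (by rw [e, hc, abs_zero])
  refine ⟨(G z)⁻¹ • G, z, ?_, hz1, by simp [hGz], ?_⟩
  · rw [norm_smul, e, norm_inv, Real.norm_eq_abs, inv_mul_cancel₀ (abs_ne_zero.2 hGz)]
  · intro y hy
    have : g0 y = 0 := hk hy
    simp [hG, this]

theorem not_stronglyAntiCoproximinal_of_finiteDimensional [FiniteDimensional ℝ X]
    (h : SmoothSpace X ∨ StrictConvexSpace ℝ X)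
    (Y : Submodule ℝ X) (hY : Y ≠ ⊤) :
    ¬ StronglyAntiCoproximinal Y := by
  obtain ⟨g, z, hg, hz, hgz, hgY⟩ := attain_aux Y hY
  have hzY : z ∉ Y := fun hc => by simp [hgY z hc] at hgz
  apply key_aux Y z hz hzY
  intro y hy hy1 f hf hfy
  have hle : |f z| ≤ 1 := by simpa [hf, hz] using f.le_opNorm z
  refine lt_of_le_of_ne hle fun heq => ?_
  rcases h with h | h
  · obtain ⟨-, k, hk⟩ := h z (by rintro rfl; simp at hz)
    have hgk : g = k := by
      have : g ∈ normingSet z := ⟨hg, by rw [hgz, hz]⟩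
      rwa [hk] at this
    rcases (abs_eq one_pos.le).1 heq with h1 | h1
    · have : f ∈ normingSet z := ⟨hf, by rw [h1, hz]⟩
      rw [hk, ← hgk] at this
      rw [mem_singleton_iff.1 this, hgY y hy] at hfy
      simp at hfy
    · have : -f ∈ normingSet z := ⟨by rw [norm_neg, hf], by simp [h1, hz]⟩
      rw [hk, ← hgk] at this
      have h2 : (-f) y = g y := by rw [mem_singleton_iff.1 this]
      rw [hgY y hy] at h2
      simp [hfy] at h2
  · rcases (abs_eq one_pos.le).1 heq with h1 | h1
    · exact hzY (sc_aux y z hy1 hz f hf hfy h1 ▸ hy)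
    · have := sc_aux y (-z) hy1 (by rw [norm_neg, hz]) f hf hfy (by simp [h1])
      exact hzY (by rw [← neg_neg z, ← this]; exact Y.neg_mem hy)
end

section
/- Let Y be a linear subspace of an n-dimensional real Banach space X. If 𝒥_Y contains n linearly independent elements, then Y is an anti-coproximinal subspace of X. -/
open Metric Set

variable {X : Type*} [NormedAddCommGroup X] [NormedSpace ℝ X]

theorem aux_james_s14 (w y : X) (f : X →L[ℝ] ℝ) (hs : SmoothPt y) (hy : ‖y‖ = 1)
    (hf : ‖f‖ = 1) (hfy : f y = 1) (ho : ∀ t : ℝ, ‖y‖ ≤ ‖y + t • w‖) : f w = 0 := by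
  obtain ⟨-, f', hf'⟩ := hs
  let S : Submodule ℝ X := Submodule.span ℝ {w}
  obtain ⟨φ, hφ1, hφ⟩ := exists_dual_vector'' ℝ (Submodule.Quotient.mk y : X ⧸ S)
  have hq : 1 ≤ ‖(Submodule.Quotient.mk y : X ⧸ S)‖ := by
    refine le_of_forall_pos_le_add fun ε hε => ?_
    obtain ⟨m, hm, hlt⟩ := Submodule.Quotient.norm_mk_lt (Submodule.Quotient.mk y : X ⧸ S) hε
    rw [Submodule.Quotient.eq] at hm
    obtain ⟨t, ht⟩ := Submodule.mem_span_singleton.1 hm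
    have h1 := ho t
    rw [ht, hy] at h1
    have : y + (m - y) = m := by abel
    rw [this] at h1
    linarith
  let g : X →L[ℝ] ℝ := φ.comp S.mkQL
  have hgle : ∀ x, ‖g x‖ ≤ 1 * ‖x‖ := fun x => by
    calc ‖g x‖ = ‖φ (Submodule.Quotient.mk x : X ⧸ S)‖ := rfl
      _ ≤ ‖φ‖ * ‖(Submodule.Quotient.mk x : X ⧸ S)‖ := φ.le_opNorm _
      _ ≤ 1 * ‖x‖ := by
        gcongr
        exact Submodule.Quotient.norm_mk_le S x
  have hg1 : ‖g‖ ≤ 1 := g.opNorm_le_bound zero_le_one hgle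
  have hgy1 : 1 ≤ g y := by
    have : g y = ‖(Submodule.Quotient.mk y : X ⧸ S)‖ := hφ
    rw [this]; exact hq
  have hgy2 : g y ≤ ‖g‖ := by
    have := g.le_opNorm y
    rw [hy, mul_one] at this
    exact (le_abs_self _).trans this
  have hgm : g ∈ normingSet y := ⟨by linarith, by rw [hy]; linarith⟩
  have hfm : f ∈ normingSet y := ⟨hf, by rw [hy, hfy]⟩
  rw [hf'] at hgm hfm
  have hfg : f = g := hfm.trans hgm.symm
  have hw : (Submodule.Quotient.mk w : X ⧸ S) = 0 :=
    (Submodule.Quotient.mk_eq_zero S).2 (Submodule.mem_span_singleton_self w)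
  have hgw : g w = φ (Submodule.Quotient.mk w : X ⧸ S) := rfl
  rw [hfg, hgw, hw, map_zero]

theorem antiCoproximinal_of_linearIndependent [FiniteDimensional ℝ X]
    (n : ℕ) (hn : Module.finrank ℝ X = n) (Y : Submodule ℝ X)
    (h : ∃ f : Fin n → (X →L[ℝ] ℝ), (∀ i, f i ∈ JsetY Y) ∧ LinearIndependent ℝ f) :
    AntiCoproximinal Y := by
  obtain ⟨f, hfJ, hli⟩ := h
  rintro x hx ⟨y₀, hy₀, hb⟩
  have ho : ∀ y ∈ Y, ∀ t : ℝ, ‖y‖ ≤ ‖y + t • (x - y₀)‖ := by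
    intro y hy t
    rcases eq_or_ne t 0 with rfl | ht
    · simp
    have h1 := hb (y₀ - t⁻¹ • y) (Y.sub_mem hy₀ (Y.smul_mem _ hy))
    have e1 : y = t • (y₀ - (y₀ - t⁻¹ • y)) := by simp [smul_smul, ht]
    have e2 : y + t • (x - y₀) = t • (x - (y₀ - t⁻¹ • y)) := by
      rw [show x - (y₀ - t⁻¹ • y) = t⁻¹ • y + (x - y₀) by abel, smul_add t, smul_smul,
        mul_inv_cancel₀ ht, one_smul]
    rw [e2]
    conv_lhs => rw [e1]
    rw [norm_smul, norm_smul]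
    gcongr
  have hz : ∀ i, f i (x - y₀) = 0 := fun i => by
    obtain ⟨h1, y, hyY, hs, hy, hfy⟩ := hfJ i
    exact aux_james_s14 _ y _ hs hy h1 hfy (ho y hyY)
  have hfr : Module.finrank ℝ (X →L[ℝ] ℝ) = n := by
    rw [← (LinearMap.toContinuousLinearMap : (X →ₗ[ℝ] ℝ) ≃ₗ[ℝ] X →L[ℝ] ℝ).finrank_eq, ← hn]
    exact Subspace.dual_finrank_eq
  have hfd : FiniteDimensional ℝ (X →L[ℝ] ℝ) :=
    (LinearMap.toContinuousLinearMap : (X →ₗ[ℝ] ℝ) ≃ₗ[ℝ] X →L[ℝ] ℝ).finiteDimensional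
  have hsp := hli.span_eq_top_of_card_eq_finrank' (by simp [hfr])
  obtain ⟨g, -, hg⟩ := exists_dual_vector'' ℝ (x - y₀)
  have hg0 : g (x - y₀) = 0 := by
    have hmem : g ∈ Submodule.span ℝ (Set.range f) := by rw [hsp]; trivial
    clear hg
    induction hmem using Submodule.span_induction with
    | mem u hu => obtain ⟨i, rfl⟩ := hu; exact hz i
    | zero => simp
    | add u v _ _ hu hv => simp only [ContinuousLinearMap.add_apply, ContinuousLinearMap.smul_apply, hu, hv]; simp
    | smul c u _ hu => simp only [ContinuousLinearMap.add_apply, ContinuousLinearMap.smul_apply, hu]; simp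
  rw [hg0] at hg
  have : x = y₀ := by
    rw [← sub_eq_zero, ← norm_eq_zero]; exact hg.symm
  exact hx (this ▸ hy₀)
end

section
/- Let a₁,…,a_m be linearly independent elements of ℓ∞^n with 1 < m < n, and let Y be their linear span. If every component of {a₁,…,a_m} satisfies the *-Property and |P_i^+ ∪ P_i^-| = 1 for all i ∈ {1,…,n}, then for every i ∈ {1,…,n} and every sign σ ∈ {+1,−1} there exists y ∈ Y with ‖y‖∞ = 1 such that y is a smooth point and J(y) = {σ eᵢ*}, where eᵢ* is the i-th coordinate functional eᵢ*(x₁,…,x_n) = x_i. -/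
open Metric Set

variable {X : Type*} [NormedAddCommGroup X] [NormedSpace ℝ X]

/-- The positively associated set `P_i^+` of the `i`-th component. -/
def Pplus {n m : ℕ} (a : Fin m → Fin n → ℝ) (i : Fin n) : Set (Fin n) :=
  {j | ∀ k, a k j = a k i}

/-- The negatively associated set `P_i^-` of the `i`-th component. -/
def Pminus {n m : ℕ} (a : Fin m → Fin n → ℝ) (i : Fin n) : Set (Fin n) :=
  {j | ∀ k, a k j = -(a k i)}

/-- The `i`-th component of `a` satisfies the `*`-Property. -/
def StarProperty {n m : ℕ} (a : Fin m → Fin n → ℝ) (i : Fin n) : Prop :=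
  ∃ β : Fin m → ℝ, ∀ j ∉ Pplus a i ∪ Pminus a i,
    |∑ k, β k * a k i| > |∑ k, β k * a k j|

theorem aux_norming_s16 {n : ℕ} (i : Fin n) (σ : ℝ) (hσ : |σ| = 1) (y : Fin n → ℝ)
    (hi : y i = σ) (hj : ∀ j, j ≠ i → |y j| < 1) :
    ‖y‖ = 1 ∧ normingSet y = {σ • (ContinuousLinearMap.proj i : (Fin n → ℝ) →L[ℝ] ℝ)} := by
  have hσ2 : σ * σ = 1 := by rw [← abs_mul_abs_self, hσ]; norm_num
  have hn : ‖y‖ = 1 := by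
    apply le_antisymm
    · rw [pi_norm_le_iff_of_nonneg zero_le_one]
      intro j
      rw [Real.norm_eq_abs]
      by_cases h : j = i
      · rw [h, hi, hσ]
      · exact (hj j h).le
    · have := norm_le_pi_norm y i
      rwa [hi, Real.norm_eq_abs, hσ] at this
  refine ⟨hn, ?_⟩
  ext f
  simp only [normingSet, Set.mem_setOf_eq, Set.mem_singleton_iff, hn]
  constructor
  · rintro ⟨hf, hfy⟩
    have hle : ∀ x, f x ≤ ‖x‖ := fun x => by
      have h1 := f.le_opNorm x
      rw [hf, one_mul] at h1
      exact (le_abs_self _).trans h1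
    have key : ∀ j, j ≠ i → f (Pi.single j 1) = 0 := by
      intro j hji
      have ht : 0 < 1 - |y j| := by linarith [hj j hji]
      have hb : ∀ s : ℝ, |s| ≤ 1 - |y j| → s * f (Pi.single j 1) ≤ 0 := by
        intro s hs
        have h2 : ‖y + s • (Pi.single j 1 : Fin n → ℝ)‖ ≤ 1 := by
          rw [pi_norm_le_iff_of_nonneg zero_le_one]
          intro l
          by_cases h : l = j
          · subst h
            simp only [Pi.add_apply, Pi.smul_apply, Pi.single_eq_same, smul_eq_mul, mul_one,
              Real.norm_eq_abs]
            linarith [abs_add_le (y l) s]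
          · have h3 := norm_le_pi_norm y l
            simp only [Pi.add_apply, Pi.smul_apply, Pi.single_eq_of_ne h, smul_zero, add_zero]
            linarith
        have h4 := hle (y + s • (Pi.single j 1 : Fin n → ℝ))
        rw [map_add, map_smul, hfy, smul_eq_mul] at h4
        linarith
      have h5 := hb (1 - |y j|) (by rw [abs_of_pos ht])
      have h6 := hb (-(1 - |y j|)) (by rw [abs_neg, abs_of_pos ht])
      have h7 : (1 - |y j|) * f (Pi.single j 1) = 0 := by linarith
      exact (mul_eq_zero.mp h7).resolve_left ht.ne'
    have hz : ∀ z : Fin n → ℝ, z i = 0 → f z = 0 := by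
      intro z hzi
      have h8 : z = ∑ j, z j • (Pi.single j 1 : Fin n → ℝ) := by
        exact pi_eq_sum_univ' z
      rw [h8, map_sum]
      apply Finset.sum_eq_zero
      intro j _
      rw [map_smul]
      by_cases h : j = i
      · rw [h, hzi, zero_smul]
      · rw [key j h, smul_zero]
    apply ContinuousLinearMap.ext
    intro x
    have h9 := hz (x - (σ * x i) • y) (by
      simp only [Pi.sub_apply, Pi.smul_apply, smul_eq_mul, hi]
      linear_combination (-x i) * hσ2)
    rw [map_sub, map_smul, hfy, smul_eq_mul, mul_one] at h9
    simp only [ContinuousLinearMap.smul_apply, ContinuousLinearMap.proj_apply, smul_eq_mul]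
    linarith
  · rintro rfl
    have hy : (σ • (ContinuousLinearMap.proj i : (Fin n → ℝ) →L[ℝ] ℝ)) y = 1 := by
      simp only [ContinuousLinearMap.smul_apply, ContinuousLinearMap.proj_apply, smul_eq_mul, hi,
        hσ2]
    refine ⟨le_antisymm ?_ ?_, hy⟩
    · apply ContinuousLinearMap.opNorm_le_bound _ zero_le_one
      intro x
      simp only [ContinuousLinearMap.smul_apply, ContinuousLinearMap.proj_apply, norm_smul]
      rw [Real.norm_eq_abs σ, hσ, one_mul, one_mul]
      exact norm_le_pi_norm x i
    · have := (σ • (ContinuousLinearMap.proj i : (Fin n → ℝ) →L[ℝ] ℝ)).le_opNorm y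
      rwa [hy, hn, mul_one, norm_one] at this

theorem exists_smooth_point_with_coordinate_support (n m : ℕ) (hm : 1 < m) (hmn : m < n)
    (a : Fin m → Fin n → ℝ) (hind : LinearIndependent ℝ a)
    (hstar : ∀ i, StarProperty a i)
    (hcard : ∀ i, (Pplus a i ∪ Pminus a i).ncard = 1) :
    ∀ i : Fin n, ∀ σ : ℝ, (σ = 1 ∨ σ = -1) →
      ∃ y ∈ Submodule.span ℝ (Set.range a), ‖y‖ = 1 ∧ SmoothPt y ∧
        normingSet y = {σ • (ContinuousLinearMap.proj i : (Fin n → ℝ) →L[ℝ] ℝ)} := by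
  intro i σ hσ
  have hσ' : |σ| = 1 := by rcases hσ with h | h <;> simp [h]
  obtain ⟨β, hβ⟩ := hstar i
  have hout : ∀ j, j ≠ i → j ∉ Pplus a i ∪ Pminus a i := by
    intro j hji hmem
    obtain ⟨c, hc⟩ := Set.ncard_eq_one.mp (hcard i)
    have hii : i ∈ Pplus a i ∪ Pminus a i := Or.inl fun _ => rfl
    rw [hc] at hmem hii
    exact hji (hmem.trans hii.symm)
  have hS : 0 < |∑ k, β k * a k i| := by
    haveI : Nontrivial (Fin n) := Fin.nontrivial_iff_two_le.mpr (by omega)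
    obtain ⟨j, hji⟩ := exists_ne i
    exact lt_of_le_of_lt (abs_nonneg _) (hβ j (hout j hji))
  set S := ∑ k, β k * a k i with hSdef
  have hS0 : S ≠ 0 := abs_pos.mp hS
  have hval : ∀ j, ((σ / S) • ∑ k, β k • a k) j = (σ / S) * ∑ k, β k * a k j := by
    intro j
    simp [Finset.sum_apply]
  obtain ⟨h1, h2⟩ := aux_norming_s16 i σ hσ' ((σ / S) • ∑ k, β k • a k)
    (by rw [hval, ← hSdef]; field_simp)
    (by
      intro j hji
      rw [hval, abs_mul, abs_div, hσ', one_div, inv_mul_lt_one₀ hS]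
      exact hβ j (hout j hji))
  refine ⟨_, ?_, h1, ⟨?_, _, h2⟩, h2⟩
  · exact Submodule.smul_mem _ _ (Submodule.sum_mem _ fun k _ =>
      Submodule.smul_mem _ _ (Submodule.subset_span ⟨k, rfl⟩))
  · intro h
    rw [h, norm_zero] at h1
    exact zero_ne_one h1
end

section
/- Let a₁,…,a_m be linearly independent elements of ℓ∞^n with 1 < m < n, and let Y be their linear span. Then the following are equivalent: (i) Y is a strongly anti-coproximinal subspace of ℓ∞^n; (ii) Y is an anti-coproximinal subspace of ℓ∞^n; (iii) every component of {a₁,…,a_m} satisfies the *-Property and |P_i^+ ∪ P_i^-| = 1 for all i ∈ {1,…,n}. -/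
open Metric Set

variable {X : Type*} [NormedAddCommGroup X] [NormedSpace ℝ X]

theorem star_iff_aux {n m : ℕ} (a : Fin m → Fin n → ℝ) (i : Fin n) :
    (StarProperty a i ∧ (Pplus a i ∪ Pminus a i).ncard = 1) ↔
      ∃ y ∈ Submodule.span ℝ (Set.range a), ∀ j, j ≠ i → |y j| < |y i| := by
  have hi : i ∈ Pplus a i ∪ Pminus a i := Or.inl (fun _ => rfl)
  constructor
  · rintro ⟨⟨β, hβ⟩, hc⟩
    obtain ⟨c, hc⟩ := Set.ncard_eq_one.1 hc
    have hci : i = c := by rw [hc] at hi; exact hi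
    subst hci
    refine ⟨∑ k, β k • a k, (Submodule.mem_span_range_iff_exists_fun ℝ).2 ⟨β, rfl⟩, ?_⟩
    intro j hj
    have := hβ j (by rw [hc]; exact hj)
    simpa [Finset.sum_apply] using this
  · rintro ⟨y, hy, h⟩
    obtain ⟨β, rfl⟩ := (Submodule.mem_span_range_iff_exists_fun ℝ).1 hy
    simp only [Finset.sum_apply, Pi.smul_apply, smul_eq_mul] at h
    have hP : Pplus a i ∪ Pminus a i = {i} := by
      apply Set.eq_singleton_iff_unique_mem.2 ⟨hi, ?_⟩
      intro j hj
      by_contra hne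
      have h1 := h j hne
      rcases hj with hj | hj
      · have hj' : ∀ k, a k j = a k i := hj
        simp [hj'] at h1
      · have hj' : ∀ k, a k j = -(a k i) := hj
        simp [hj'] at h1
    refine ⟨⟨β, fun j hj => ?_⟩, ?_⟩
    · rw [hP] at hj
      exact h j hj
    · rw [hP]; simp

theorem strong_imp_anti {X : Type*} [NormedAddCommGroup X] [NormedSpace ℝ X]
    (Y : Submodule ℝ X) (h : StronglyAntiCoproximinal Y) : AntiCoproximinal Y := by
  rintro x hx ⟨y₀, hy₀, hb⟩
  refine h x hx 0 le_rfl one_pos ⟨y₀, hy₀, ?_⟩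
  intro y hy t
  rcases eq_or_ne t 0 with rfl | ht
  · simp
  have h1 := hb (y₀ - t⁻¹ • y) (Y.sub_mem hy₀ (Y.smul_mem _ hy))
  have e1 : y + t • (x - y₀) = t • (x - (y₀ - t⁻¹ • y)) := by
    simp only [smul_sub, smul_smul, mul_inv_cancel₀ ht, one_smul]; abel
  have e2 : y = t • (y₀ - (y₀ - t⁻¹ • y)) := by
    simp only [smul_sub, smul_smul, mul_inv_cancel₀ ht, one_smul]; abel
  have h2 : ‖y‖ = ‖t‖ * ‖y₀ - (y₀ - t⁻¹ • y)‖ := by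
    rw [← norm_smul, ← e2]
  rw [e1, norm_smul, h2]
  have := mul_le_mul_of_nonneg_left h1 (norm_nonneg t)
  linarith

theorem anti_imp_aux {n : ℕ} (Y : Submodule ℝ (Fin n → ℝ)) (hn : 1 < n)
    (h : AntiCoproximinal Y) (i : Fin n) :
    ∃ y ∈ Y, ∀ j, j ≠ i → |y j| < |y i| := by
  by_contra! hc
  refine h (Pi.single i 1) ?_ ⟨0, Y.zero_mem, ?_⟩
  · intro hmem
    obtain ⟨j, hj, hle⟩ := hc _ hmem
    simp [Pi.single_eq_of_ne hj] at hle
    linarith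
  · intro y hy
    have key : ∀ j, j ≠ i → |y j| ≤ ‖Pi.single i 1 - y‖ := by
      intro j hj
      have := norm_le_pi_norm (Pi.single i (1:ℝ) - y) j
      simpa [Pi.single_eq_of_ne hj] using this
    rw [zero_sub, norm_neg, pi_norm_le_iff_of_nonneg (norm_nonneg _)]
    intro j
    rw [Real.norm_eq_abs]
    rcases eq_or_ne j i with rfl | hj
    · obtain ⟨k, hk, hle⟩ := hc y hy
      exact hle.trans (key k hk)
    · exact key j hj

theorem aux_imp_strong {n : ℕ} (Y : Submodule ℝ (Fin n → ℝ)) (hn : 1 < n)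
    (h : ∀ i : Fin n, ∃ y ∈ Y, ∀ j, j ≠ i → |y j| < |y i|) :
    StronglyAntiCoproximinal Y := by
  rintro x hx ε h0 h1 ⟨y₀, hy₀, hb⟩
  set v := x - y₀ with hv
  have hv0 : v ≠ 0 := by
    intro h0
    apply hx
    rw [sub_eq_zero.1 h0]; exact hy₀
  have hpos : 0 < ‖v‖ := norm_pos_iff.2 hv0
  haveI : Nonempty (Fin n) := ⟨⟨0, by omega⟩⟩
  obtain ⟨i, hi⟩ := Finite.exists_max (fun i => ‖v i‖)
  have hvi : ‖v‖ = |v i| :=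
    le_antisymm ((pi_norm_le_iff_of_nonneg (norm_nonneg _)).2 hi) (norm_le_pi_norm v i)
  obtain ⟨y, hy, hlt⟩ := h i
  have hex : ∃ δ > 0, ∀ j, j ≠ i → |y j| + δ ≤ |y i| := by
    obtain ⟨k, hk⟩ := Finite.exists_min (fun j : Fin n => if j = i then 1 else |y i| - |y j|)
    refine ⟨if k = i then 1 else |y i| - |y k|, ?_, ?_⟩
    · split_ifs with hki
      · exact one_pos
      · have := hlt k hki
        simp only [gt_iff_lt]; linarith
    · intro j hj
      have := hk j
      simp only [if_neg hj] at this
      linarith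
  obtain ⟨δ, hδ, hd⟩ := hex
  have hyi : δ ≤ |y i| := by
    haveI : Nontrivial (Fin n) := Fin.nontrivial_iff_two_le.2 hn
    obtain ⟨j, hj⟩ := exists_ne i
    have := hd j hj
    have := abs_nonneg (y j)
    linarith
  have hyn : |y i| ≤ ‖y‖ := norm_le_pi_norm y i
  -- step size
  set s := δ / (2 * ‖v‖) with hs
  have hspos : 0 < s := by positivity
  have hsv : s * ‖v‖ = δ / 2 := by rw [hs]; field_simp
  obtain ⟨t, ht, hti⟩ : ∃ t : ℝ, |t| = s ∧ |y i + t * v i| ≤ |y i| - s * ‖v‖ := by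
    rw [hvi] at hsv ⊢
    have hsa : |s| = s := abs_of_pos hspos
    rcases abs_cases (y i) with ⟨e1, _⟩ | ⟨e1, _⟩ <;> rcases abs_cases (v i) with ⟨e2, _⟩ | ⟨e2, _⟩ <;>
      rw [e2] at hsv ⊢ <;> rw [e1] at hyi ⊢
    · exact ⟨-s, by rw [abs_neg, hsa], abs_le.2 ⟨by linarith, by linarith⟩⟩
    · exact ⟨s, hsa, abs_le.2 ⟨by linarith, by linarith⟩⟩
    · exact ⟨s, hsa, abs_le.2 ⟨by linarith, by linarith⟩⟩
    · exact ⟨-s, by rw [abs_neg, hsa], abs_le.2 ⟨by linarith, by linarith⟩⟩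
  have hub : ‖y + t • v‖ ≤ |y i| - s * ‖v‖ := by
    rw [pi_norm_le_iff_of_nonneg (by linarith)]
    intro j
    rw [Real.norm_eq_abs, Pi.add_apply, Pi.smul_apply, smul_eq_mul]
    rcases eq_or_ne j i with rfl | hj
    · exact hti
    · have h2 := abs_add_le (y j) (t * v j)
      have h3 : |t * v j| ≤ s * ‖v‖ := by
        rw [abs_mul, ht]
        exact mul_le_mul_of_nonneg_left (norm_le_pi_norm v j) hspos.le
      have := hd j hj
      linarith
  have h4 := hb y hy t
  rw [norm_smul, Real.norm_eq_abs, ht, hsv] at h4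
  rw [hsv] at hub
  nlinarith

theorem linfty_antiCoproximinal_tfae (n m : ℕ) (hm : 1 < m) (hmn : m < n)
    (a : Fin m → Fin n → ℝ) (hind : LinearIndependent ℝ a) :
    (StronglyAntiCoproximinal (Submodule.span ℝ (Set.range a)) ↔
      AntiCoproximinal (Submodule.span ℝ (Set.range a))) ∧
    (AntiCoproximinal (Submodule.span ℝ (Set.range a)) ↔
      ∀ i : Fin n, StarProperty a i ∧ (Pplus a i ∪ Pminus a i).ncard = 1) := by
  have hn : 1 < n := hm.trans hmn
  refine ⟨⟨strong_imp_anti _, fun h => aux_imp_strong _ hn (anti_imp_aux _ hn h)⟩, ?_⟩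
  simp only [star_iff_aux]
  exact ⟨fun h => anti_imp_aux _ hn h, fun h => strong_imp_anti _ (aux_imp_strong _ hn h)⟩
end

section
/- Let a₁,…,a_m be linearly independent elements of ℓ₁^n with 1 < m < n, where a_k = (a₁^k,…,a_n^k), and let Y be their linear span. If there exists j ∈ {1,…,n} such that a_j^k = 0 for all k ∈ {1,…,m}, then Y is not an anti-coproximinal subspace of ℓ₁^n. -/
open Metric Set

variable {X : Type*} [NormedAddCommGroup X] [NormedSpace ℝ X]

theorem l1_not_antiCoproximinal_of_zero_component (n m : ℕ) (hm : 1 < m) (hmn : m < n)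
    (a : Fin m → PiLp 1 fun _ : Fin n => ℝ) (hind : LinearIndependent ℝ a)
    (j : Fin n) (hj : ∀ k, a k j = 0) :
    ¬ AntiCoproximinal (Submodule.span ℝ (Set.range a)) := by
  intro h
  have hY : ∀ y ∈ Submodule.span ℝ (Set.range a), y j = 0 := by
    intro y hy
    induction hy using Submodule.span_induction with
    | mem x hx => obtain ⟨k, rfl⟩ := hx; exact hj k
    | zero => simp
    | add x y _ _ hx hy => simp [hx, hy]
    | smul c x _ hx => simp [hx]
  have hn : ∀ z : PiLp 1 fun _ : Fin n => ℝ, ‖z‖ = ∑ i, ‖z i‖ := by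
    intro z
    simp [PiLp.norm_eq_sum (p := 1) (by norm_num) z]
  refine h (WithLp.toLp 1 (Pi.single j (1 : ℝ))) (fun hx => ?_) ⟨0, Submodule.zero_mem _, ?_⟩
  · have := hY _ hx
    simp at this
  · intro y hy
    rw [hn, hn]
    refine Finset.sum_le_sum fun i _ => ?_
    by_cases hi : i = j
    · subst hi
      simp [hY y hy]
    · simp [hi]
end

section
/- Let n ≥ 3. Then no proper linear subspace Y of ℓ₁^n with dim Y > 1 is a strongly anti-coproximinal subspace of ℓ₁^n. -/
open Metric Set

variable {X : Type*} [NormedAddCommGroup X] [NormedSpace ℝ X]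

theorem l1_no_stronglyAntiCoproximinal (n : ℕ) (hn : 3 ≤ n)
    (Y : Submodule ℝ (PiLp 1 fun _ : Fin n => ℝ)) (hY : Y ≠ ⊤)
    (hdim : 1 < Module.finrank ℝ Y) :
    ¬ StronglyAntiCoproximinal Y := by
  intro H
  obtain ⟨f, hf0, hf⟩ := Submodule.exists_le_ker_of_lt_top Y (lt_top_iff_ne_top.mpr hY)
  obtain ⟨z, hz⟩ : ∃ z : PiLp 1 fun _ : Fin n => ℝ, ∀ y, f y = ∑ i, y i * z i := by
    refine ⟨WithLp.toLp 1 fun i => f (PiLp.basisFun 1 ℝ (Fin n) i), fun y => ?_⟩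
    conv_lhs => rw [← (PiLp.basisFun 1 ℝ (Fin n)).sum_repr y, map_sum]
    simp only [map_smul, PiLp.basisFun_repr, smul_eq_mul]
  have hzero : ∀ y ∈ Y, ∑ i, y i * z i = 0 := fun y hy => by
    rw [← hz]; exact hf hy
  have hne : ∃ i, z i ≠ 0 := by
    by_contra! h
    exact hf0 (LinearMap.ext fun y => by simp [hz, h])
  have hzY : z ∉ Y := by
    intro h
    obtain ⟨i, hi⟩ := hne
    have h1 := (Finset.sum_eq_zero_iff_of_nonneg
      (fun i _ => mul_self_nonneg (z i))).1 (hzero z h) i (Finset.mem_univ i)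
    exact hi (mul_self_eq_zero.1 h1)
  have hnorm : ∀ w : PiLp 1 fun _ : Fin n => ℝ, ‖w‖ = ∑ i, |w i| := fun w => by
    simpa using PiLp.norm_eq_of_L1 w
  obtain ⟨i₀, hi₀⟩ := hne
  obtain ⟨k, hk, hmin⟩ := Finset.exists_min_image (Finset.univ.filter fun i => z i ≠ 0)
    (fun i => |z i|) ⟨i₀, by simpa using hi₀⟩
  have hk0 : 0 < |z k| := abs_pos.2 (by simpa using hk)
  have hkle : |z k| ≤ ‖z‖ := by
    rw [hnorm]
    exact Finset.single_le_sum (f := fun i => |z i|) (fun i _ => abs_nonneg _) (Finset.mem_univ k)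
  have hzpos : 0 < ‖z‖ := hk0.trans_le hkle
  refine H z hzY (1 - |z k| / ‖z‖) ?_ ?_ ⟨0, Y.zero_mem, ?_⟩
  · have := (div_le_one hzpos).2 hkle
    linarith
  · have := div_pos hk0 hzpos
    linarith
  intro y hy t
  rw [sub_zero, norm_smul, Real.norm_eq_abs]
  have e : (1 - |z k| / ‖z‖) * (|t| * ‖z‖) = |t| * ‖z‖ - |t| * |z k| := by
    field_simp
  rw [e]
  obtain ⟨j, hj0, hj⟩ : ∃ j, z j ≠ 0 ∧ 0 ≤ y j * (t * z j) := by
    by_contra! h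
    have hs : ∑ i, y i * (t * z i) = 0 := by
      have : ∑ i, y i * (t * z i) = t * ∑ i, y i * z i := by
        rw [Finset.mul_sum]; exact Finset.sum_congr rfl fun i _ => by ring
      rw [this, hzero y hy, mul_zero]
    have : ∑ i, y i * (t * z i) < ∑ i : Fin n, (0:ℝ) := by
      refine Finset.sum_lt_sum (fun i _ => ?_) ⟨i₀, Finset.mem_univ _, h i₀ hi₀⟩
      by_cases hi : z i = 0
      · simp [hi]
      · exact (h i hi).le
    simp [hs] at this
  have hkj : |z k| ≤ |z j| := hmin j (by simpa using hj0)
  have key : ∑ i, (|y i| - |t| * |z i| + if i = j then |t| * |z j| else 0) ≤ ∑ i, |(y + t • z) i| := by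
    refine Finset.sum_le_sum fun i _ => ?_
    simp only [PiLp.add_apply, PiLp.smul_apply, smul_eq_mul]
    split_ifs with hij
    · subst hij
      have h2 : |y i + t * z i| = |y i| + |t * z i| := by
        rw [abs_add_eq_add_abs_iff]
        rcases mul_nonneg_iff.1 hj with h | h
        · exact Or.inl h
        · exact Or.inr h
      rw [h2]
      have := abs_nonneg (t * z i)
      linarith
    · have h3 := abs_sub_abs_le_abs_sub (y i) (-(t * z i))
      rw [abs_neg, abs_mul, sub_neg_eq_add] at h3
      linarith
  rw [Finset.sum_add_distrib, Finset.sum_sub_distrib, ← Finset.mul_sum] at key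
  simp only [Finset.sum_ite_eq', Finset.mem_univ, if_true] at key
  rw [hnorm (y + t • z), hnorm y, hnorm z]
  have := mul_le_mul_of_nonneg_left hkj (abs_nonneg t)
  linarith
end
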